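/- arXiv:2010.14593 — 7 statements merged into one kernel-verified Lean document; each statement's English description precedes it below -/
import Mathlib

section
/- Let Z be a C*-ternary ring. Given finitely many elements f₁,…,fₙ, g₁,…,gₙ ∈ Z, define bounded linear operators U₁, U₂ on Z by U₁x = Σᵢ [x fᵢ gᵢ] and U₂x = Σᵢ [x gᵢ fᵢ]. Then max(‖U₁‖, ‖U₂‖)² = max(‖U₂∘U₁‖, ‖U₁∘U₂‖), where ‖·‖ denotes the operator norm on Z. (This is the C*-identity ‖Ū U‖ = ‖U‖² making the closure of R(Z) = span{([·fg],[·gf]) : f,g ∈ Z}, with involution (B₁,B₂) ↦ (B₂,B₁), a C*-algebra.) -/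
/-- A C*-ternary ring: a complex Banach space `Z` (completeness is imposed where needed)
with a triple product `[x y z] = t x y z`, linear in the outer variables, conjugate-linear in
the middle variable, associative in the sense that
`[[v w x] y z] = [v [y x w] z] = [v w [x y z]]`, and satisfying
`‖[x y z]‖ ≤ ‖x‖‖y‖‖z‖` and `‖[x x x]‖ = ‖x‖³`. -/
structure CstarTernary (Z : Type*) [NormedAddCommGroup Z] [NormedSpace ℂ Z] where
  t : Z → Z → Z → Z
  add_left : ∀ x w y z, t (x + w) y z = t x y z + t w y z
  smul_left : ∀ (c : ℂ) (x y z), t (c • x) y z = c • t x y z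
  add_mid : ∀ x y w z, t x (y + w) z = t x y z + t x w z
  smul_mid : ∀ (c : ℂ) (x y z), t x (c • y) z = (starRingEnd ℂ) c • t x y z
  add_right : ∀ x y z w, t x y (z + w) = t x y z + t x y w
  smul_right : ∀ (c : ℂ) (x y z), t x y (c • z) = c • t x y z
  assoc₁ : ∀ v w x y z, t (t v w x) y z = t v (t y x w) z
  assoc₂ : ∀ v w x y z, t (t v w x) y z = t v w (t x y z)
  norm_le : ∀ x y z, ‖t x y z‖ ≤ ‖x‖ * ‖y‖ * ‖z‖
  norm_cube : ∀ x, ‖t x x x‖ = ‖x‖ ^ 3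

namespace CstarTernary

variable {Z : Type*} [NormedAddCommGroup Z] [NormedSpace ℂ Z] (S : CstarTernary Z)

theorem sum_left {ι : Type*} (s : Finset ι) (u : ι → Z) (y z : Z) :
    S.t (∑ i ∈ s, u i) y z = ∑ i ∈ s, S.t (u i) y z :=
  map_sum (AddMonoidHom.mk' (fun x => S.t x y z) fun a b => S.add_left a b y z) u s

theorem sum_mid {ι : Type*} (s : Finset ι) (x : Z) (u : ι → Z) (z : Z) :
    S.t x (∑ i ∈ s, u i) z = ∑ i ∈ s, S.t x (u i) z :=
  map_sum (AddMonoidHom.mk' (fun y => S.t x y z) fun a b => S.add_mid x a b z) u s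

/-- The operators `Σᵢ [· fᵢ gᵢ]` and `Σᵢ [· gᵢ fᵢ]` are formally adjoint for the first two
variables of the triple product. -/
theorem t_sum_left_eq_t_sum_mid {ι : Type*} (s : Finset ι) (f g : ι → Z) (x y z : Z) :
    S.t (∑ i ∈ s, S.t x (f i) (g i)) y z = S.t x (∑ i ∈ s, S.t y (g i) (f i)) z := by
  simp only [sum_left, sum_mid, S.assoc₁]

/-- If `V` is a formal adjoint of `U` then `‖U‖² ≤ ‖V ∘ U‖`. -/
theorem sq_norm_le_norm_comp (U V : Z →L[ℂ] Z)
    (h : ∀ x y z, S.t (U x) y z = S.t x (V y) z) : ‖U‖ ^ 2 ≤ ‖V.comp U‖ := by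
  refine (Real.le_sqrt (norm_nonneg _) (norm_nonneg _)).1 ?_
  refine U.opNorm_le_bound (Real.sqrt_nonneg _) fun x => ?_
  rcases (norm_nonneg (U x)).eq_or_lt with h0 | hpos
  · rw [← h0]
    positivity
  have hcube : ‖U x‖ ^ 2 * ‖U x‖ ≤ ‖V.comp U‖ * ‖x‖ ^ 2 * ‖U x‖ :=
    calc ‖U x‖ ^ 2 * ‖U x‖ = ‖S.t x (V (U x)) (U x)‖ := by
          rw [← h, S.norm_cube, ← pow_succ]
      _ ≤ ‖x‖ * ‖V (U x)‖ * ‖U x‖ := S.norm_le _ _ _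
      _ ≤ ‖x‖ * (‖V.comp U‖ * ‖x‖) * ‖U x‖ := by
          gcongr
          exact (V.comp U).le_opNorm x
      _ = ‖V.comp U‖ * ‖x‖ ^ 2 * ‖U x‖ := by ring
  refine (pow_le_pow_iff_left₀ (norm_nonneg _) (by positivity) two_ne_zero).1 ?_
  rw [mul_pow, Real.sq_sqrt (norm_nonneg _)]
  exact le_of_mul_le_mul_right hcube hpos

end CstarTernary

/-- The C*-identity for the right multiplication algebra of a C*-ternary ring `Z`: given
`f₁,…,fₙ, g₁,…,gₙ ∈ Z`, with `U₁ x = Σᵢ [x fᵢ gᵢ]` and `U₂ x = Σᵢ [x gᵢ fᵢ]`, one has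
`max(‖U₁‖, ‖U₂‖)² = max(‖U₂∘U₁‖, ‖U₁∘U₂‖)`.  (This is the identity `‖Ū U‖ = ‖U‖²` making
the closure of `R(Z) = span{([·fg],[·gf])}`, with involution `(B₁,B₂) ↦ (B₂,B₁)`, a
C*-algebra.) -/
theorem cstarTernary_right_algebra_cstar_identity
    {Z : Type*} [NormedAddCommGroup Z] [NormedSpace ℂ Z] [CompleteSpace Z]
    (S : CstarTernary Z) (n : ℕ) (f g : Fin n → Z)
    (U₁ U₂ : Z →L[ℂ] Z)
    (hU₁ : ∀ x, U₁ x = ∑ i, S.t x (f i) (g i))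
    (hU₂ : ∀ x, U₂ x = ∑ i, S.t x (g i) (f i)) :
    (max ‖U₁‖ ‖U₂‖) ^ 2 = max ‖U₂.comp U₁‖ ‖U₁.comp U₂‖ := by
  have h₁ := S.sq_norm_le_norm_comp U₁ U₂ fun x y z => by
    rw [hU₁, hU₂, S.t_sum_left_eq_t_sum_mid]
  have h₂ := S.sq_norm_le_norm_comp U₂ U₁ fun x y z => by
    rw [hU₁, hU₂, S.t_sum_left_eq_t_sum_mid]
  apply le_antisymm
  · rcases max_choice ‖U₁‖ ‖U₂‖ with h | h <;> rw [h]
    · exact h₁.trans (le_max_left _ _)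
    · exact h₂.trans (le_max_right _ _)
  · rw [sq]
    refine max_le ((U₂.opNorm_comp_le U₁).trans ?_) ((U₁.opNorm_comp_le U₂).trans ?_)
    · gcongr
      exacts [le_max_right _ _, le_max_left _ _]
    · gcongr
      exacts [le_max_left _ _, le_max_right _ _]
end

section
/- Every surjective homomorphism between C*-ternary rings is contractive: if M and N are C*-ternary rings and φ : M → N is a surjective linear map satisfying φ([x y z]) = [φ(x) φ(y) φ(z)] for all x, y, z ∈ M, then ‖φ(x)‖ ≤ ‖x‖ for all x ∈ M. -/
open Filter Topology in
/-- A bounded operator `T` with `‖T ^ n‖ = r ^ n` for all `n` has a spectral value of modulus `r`. -/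
theorem exists_mem_spectrum_norm_eq_of_norm_pow_eq {E : Type*} [NormedAddCommGroup E]
    [NormedSpace ℂ E] [CompleteSpace E] [Nontrivial E] (T : E →L[ℂ] E) {r : ℝ} (hr : 0 ≤ r)
    (hT : ∀ n, ‖T ^ n‖ = r ^ n) : ∃ z ∈ spectrum ℂ T, ‖z‖ = r := by
  obtain ⟨z, hz, hzr⟩ := spectrum.exists_nnnorm_eq_spectralRadius T
  refine ⟨z, hz, ?_⟩
  have h1 := spectrum.pow_norm_pow_one_div_tendsto_nhds_spectralRadius T
  have h2 : Tendsto (fun n : ℕ => ENNReal.ofReal (‖T ^ n‖ ^ (1 / n : ℝ))) atTop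
      (𝓝 (ENNReal.ofReal r)) := by
    refine tendsto_const_nhds.congr' ?_
    filter_upwards [eventually_ne_atTop 0] with n hn
    rw [hT, one_div, Real.pow_rpow_inv_natCast hr hn]
  have h3 := tendsto_nhds_unique h1 h2
  rw [← hzr, ← ENNReal.ofReal_coe_nnreal, coe_nnnorm,
    ENNReal.ofReal_eq_ofReal_iff (norm_nonneg z) hr] at h3
  exact h3

/-- A spectral value `z` of `T` with `‖T‖ ≤ ‖z‖` and `z ≠ 0` is in the surjectivity spectrum. -/
theorem not_surjective_of_mem_spectrum_of_norm_le {E : Type*} [NormedAddCommGroup E]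
    [NormedSpace ℂ E] [CompleteSpace E] [Nontrivial E] (T : E →L[ℂ] E) {z : ℂ}
    (hz : z ∈ spectrum ℂ T) (hz0 : z ≠ 0) (hT : ‖T‖ ≤ ‖z‖) :
    ¬ ∀ y, ∃ w, z • w - T w = y := by
  intro hsurj
  have hinj : ∀ x, z • x - T x = 0 → x = 0 := by
    intro x hx
    obtain ⟨w, hw⟩ := hsurj x
    have hTx : T x = z • x := (sub_eq_zero.mp hx).symm
    have hTw : T w = z • w - x := by rw [← hw]; abel
    have hpow : ∀ n : ℕ, z • (T ^ n) w = z ^ n • (z • w - (n : ℂ) • x) := by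
      intro n
      induction n with
      | zero => simp
      | succ n ih =>
        have h := congrArg T ih
        simp only [map_smul, map_sub, hTx, hTw] at h
        rw [pow_succ', mul_apply_eq_comp, h]
        push_cast
        module
    have hbound : ∀ n : ℕ, n * ‖x‖ ≤ 2 * ‖z • w‖ := by
      intro n
      have h1 : ‖z‖ ^ n * ‖z • w - (n : ℂ) • x‖ ≤ ‖z‖ ^ n * ‖z • w‖ := by
        rw [← norm_pow, ← norm_smul, ← hpow, norm_smul, norm_smul, norm_pow]
        calc ‖z‖ * ‖(T ^ n) w‖ ≤ ‖z‖ * (‖z‖ ^ n * ‖w‖) := by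
              gcongr
              refine ContinuousLinearMap.le_of_opNorm_le _ ?_ _
              refine (norm_pow_le T n).trans ?_
              gcongr
          _ = ‖z‖ ^ n * (‖z‖ * ‖w‖) := by ring
      have h2 := le_of_mul_le_mul_left h1 (pow_pos (norm_pos_iff.mpr hz0) n)
      have h3 : ‖(n : ℂ) • x‖ ≤ ‖z • w‖ + ‖z • w - (n : ℂ) • x‖ := by
        simpa using norm_sub_le (z • w) (z • w - (n : ℂ) • x)
      rw [norm_smul, Complex.norm_natCast] at h3
      linarith
    by_contra hx0
    have hpos : 0 < ‖x‖ := norm_pos_iff.mpr hx0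
    obtain ⟨n, hn⟩ := exists_nat_gt (2 * ‖z • w‖ / ‖x‖)
    rw [div_lt_iff₀ hpos] at hn
    linarith [hbound n]
  apply hz
  refine ContinuousLinearMap.isUnit_iff_bijective.mpr ?_
  have happ : ∀ x, (algebraMap ℂ (E →L[ℂ] E) z - T) x = z • x - T x := fun x => by
    simp [Algebra.algebraMap_eq_smul_one]
  refine ⟨(injective_iff_map_eq_zero _).mpr fun x hx => hinj x (by rwa [happ] at hx),
    fun y => ?_⟩
  obtain ⟨w, hw⟩ := hsurj y
  exact ⟨w, by rw [happ, hw]⟩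

namespace CstarTernary

variable {Z : Type*} [NormedAddCommGroup Z] [NormedSpace ℂ Z] (S : CstarTernary Z)

/-- The left multiplication operator `z ↦ [b b z]`. -/
noncomputable def leftMul (b : Z) : Z →L[ℂ] Z :=
  LinearMap.mkContinuous
    { toFun := S.t b b
      map_add' := S.add_right b b
      map_smul' := fun c z => S.smul_right c b b z }
    (‖b‖ ^ 2) fun z => by
      simpa [sq] using S.norm_le b b z

@[simp]
theorem leftMul_apply (b z : Z) : S.leftMul b z = S.t b b z := rfl

theorem norm_leftMul_le (b : Z) : ‖S.leftMul b‖ ≤ ‖b‖ ^ 2 :=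
  LinearMap.mkContinuous_norm_le _ (by positivity) _

theorem t_leftMul_pow (b : Z) (m n : ℕ) (z : Z) :
    S.t ((S.leftMul b ^ m) b) ((S.leftMul b ^ n) b) z = (S.leftMul b ^ (m + n + 1)) z := by
  induction m with
  | zero =>
    induction n generalizing z with
    | zero => simp
    | succ n ih =>
      rw [pow_zero, one_apply_eq_self] at ih ⊢
      rw [pow_succ' _ n, mul_apply_eq_comp, leftMul_apply, ← S.assoc₁, S.assoc₂,
        ih, ← leftMul_apply, ← mul_apply_eq_comp, ← pow_succ]
      congr 2
  | succ m ih =>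
    rw [pow_succ' _ m, mul_apply_eq_comp, leftMul_apply, S.assoc₂, ih,
      ← leftMul_apply, ← mul_apply_eq_comp, ← pow_succ']
    congr 2
    ring

theorem norm_leftMul_pow_le [Nontrivial Z] (b : Z) (n : ℕ) : ‖S.leftMul b ^ n‖ ≤ (‖b‖ ^ 2) ^ n :=
  (norm_pow_le _ n).trans
    (pow_le_pow_left₀ (norm_nonneg _) (S.norm_leftMul_le b) n)

theorem exists_le_norm_leftMul_pow_apply (b : Z) (n : ℕ) :
    ∃ m, n ≤ m ∧ ‖(S.leftMul b ^ m) b‖ = ‖b‖ ^ (2 * m + 1) := by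
  induction n with
  | zero => exact ⟨0, le_rfl, by simp⟩
  | succ n ih =>
    obtain ⟨m, hnm, hm⟩ := ih
    refine ⟨3 * m + 1, by omega, ?_⟩
    have h := S.norm_cube ((S.leftMul b ^ m) b)
    rw [S.t_leftMul_pow, ← mul_apply_eq_comp, ← pow_add, hm, ← pow_mul] at h
    convert h using 3
    · congr 1
      ring
    · ring

theorem norm_leftMul_pow {b : Z} (hb : b ≠ 0) (n : ℕ) :
    ‖S.leftMul b ^ n‖ = (‖b‖ ^ 2) ^ n := by
  have : Nontrivial Z := ⟨b, 0, hb⟩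
  refine (S.norm_leftMul_pow_le b n).antisymm ?_
  obtain ⟨m, hnm, hm⟩ := S.exists_le_norm_leftMul_pow_apply b n
  obtain ⟨k, rfl⟩ := Nat.exists_eq_add_of_le' hnm
  have hb' : 0 < ‖b‖ := norm_pos_iff.mpr hb
  have h : ‖b‖ ^ (2 * k + 1) * (‖b‖ ^ 2) ^ n ≤ ‖b‖ ^ (2 * k + 1) * ‖S.leftMul b ^ n‖ :=
    calc ‖b‖ ^ (2 * k + 1) * (‖b‖ ^ 2) ^ n = ‖b‖ ^ (2 * (k + n) + 1) := by ring
      _ = ‖(S.leftMul b ^ k) ((S.leftMul b ^ n) b)‖ := by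
        rw [← hm, pow_add, mul_apply_eq_comp]
      _ ≤ (‖b‖ ^ 2) ^ k * (‖S.leftMul b ^ n‖ * ‖b‖) :=
        ContinuousLinearMap.le_of_opNorm_le_of_le _ (S.norm_leftMul_pow_le b k)
          (ContinuousLinearMap.le_opNorm _ _)
      _ = ‖b‖ ^ (2 * k + 1) * ‖S.leftMul b ^ n‖ := by ring
  exact le_of_mul_le_mul_left h (by positivity)

end CstarTernary

/-- Every surjective homomorphism between C*-ternary rings is contractive: if `M` and `N` are
C*-ternary rings and `φ : M → N` is a surjective linear map satisfying
`φ [x y z] = [φ x, φ y, φ z]`, then `‖φ x‖ ≤ ‖x‖` for all `x`. -/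
theorem cstarTernary_surjective_hom_contractive
    {M : Type*} [NormedAddCommGroup M] [NormedSpace ℂ M] [CompleteSpace M]
    {N : Type*} [NormedAddCommGroup N] [NormedSpace ℂ N] [CompleteSpace N]
    (SM : CstarTernary M) (SN : CstarTernary N)
    (φ : M →ₗ[ℂ] N) (hsurj : Function.Surjective φ)
    (hhom : ∀ x y z, φ (SM.t x y z) = SN.t (φ x) (φ y) (φ z)) :
    ∀ x : M, ‖φ x‖ ≤ ‖x‖ := by
  intro a
  by_contra! hlt
  have hb : φ a ≠ 0 := norm_pos_iff.mp ((norm_nonneg a).trans_lt hlt)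
  have : Nontrivial N := ⟨φ a, 0, hb⟩
  obtain ⟨z, hz, hzn⟩ := exists_mem_spectrum_norm_eq_of_norm_pow_eq (SN.leftMul (φ a))
    (sq_nonneg _) (SN.norm_leftMul_pow hb)
  have hz0 : z ≠ 0 := norm_pos_iff.mp (hzn ▸ pow_pos (norm_pos_iff.mpr hb) 2)
  refine not_surjective_of_mem_spectrum_of_norm_le _ hz hz0
    ((SN.norm_leftMul_le _).trans hzn.ge) fun y => ?_
  have : Nontrivial M := ⟨a, 0, fun h => hb (by rw [h, map_zero])⟩
  have hres : z ∈ resolventSet ℂ (SM.leftMul a) := by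
    refine spectrum.mem_resolventSet_of_norm_lt ((SM.norm_leftMul_le a).trans_lt ?_)
    rw [hzn]
    gcongr
  have hbij := ContinuousLinearMap.isUnit_iff_bijective.mp hres
  obtain ⟨m, rfl⟩ := hsurj y
  obtain ⟨w, rfl⟩ := hbij.2 m
  exact ⟨φ w, by simp [Algebra.algebraMap_eq_smul_one, hhom]⟩
end

section
/- Let E₁, E₂, E₃, E₁₂, E₂₃, E₁₃ be complex Banach spaces equipped with bounded bilinear maps m₂₁ : E₂×E₁ → E₁₂, m₃₂ : E₃×E₂ → E₂₃, p : E₃×E₁₂ → E₁₃ and q : E₂₃×E₁ → E₁₃ satisfying the associativity law p(c, m₂₁(b,a)) = q(m₃₂(c,b), a) for all a ∈ E₁, b ∈ E₂, c ∈ E₃ (as for composition in a linear category). Then the Arens extensions to the biduals satisfy p″(H, m₂₁″(G, F)) = q″(m₃₂″(H, G), F) for all F ∈ E₁″, G ∈ E₂″, H ∈ E₃″. -/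
noncomputable section

open ContinuousLinearMap

/-- The (first) Arens extension `m″ : F″ × E″ → G″` of a bounded bilinear map
`m : F × E → G` (given as `m : F →L[ℂ] E →L[ℂ] G`), determined by
`⟨b·f, a⟩ = ⟨f, m(b,a)⟩`, `⟨f·Φ, b⟩ = ⟨Φ, b·f⟩` and `⟨m″(Ψ,Φ), f⟩ = ⟨Ψ, f·Φ⟩`. -/
def arensBL {E F G : Type*}
    [NormedAddCommGroup E] [NormedSpace ℂ E]
    [NormedAddCommGroup F] [NormedSpace ℂ F]
    [NormedAddCommGroup G] [NormedSpace ℂ G]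
    (m : F →L[ℂ] E →L[ℂ] G)
    (Ψ : (F →L[ℂ] ℂ) →L[ℂ] ℂ) (Φ : (E →L[ℂ] ℂ) →L[ℂ] ℂ) :
    (G →L[ℂ] ℂ) →L[ℂ] ℂ :=
  Ψ.comp ((ContinuousLinearMap.compL ℂ F (E →L[ℂ] ℂ) ℂ Φ).comp
    (((ContinuousLinearMap.compL ℂ F (E →L[ℂ] G) (E →L[ℂ] ℂ)).flip m).comp
      (ContinuousLinearMap.compL ℂ E G ℂ)))

/-- Let `E₁, E₂, E₃, E₁₂, E₂₃, E₁₃` be complex Banach spaces with bounded bilinear maps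
`m₂₁ : E₂×E₁ → E₁₂`, `m₃₂ : E₃×E₂ → E₂₃`, `p : E₃×E₁₂ → E₁₃`, `q : E₂₃×E₁ → E₁₃`
satisfying `p(c, m₂₁(b,a)) = q(m₃₂(c,b), a)` (as for composition in a linear category).
Then the Arens extensions satisfy `p″(H, m₂₁″(G, F)) = q″(m₃₂″(H, G), F)` for all
`F ∈ E₁″`, `G ∈ E₂″`, `H ∈ E₃″`. -/
theorem arens_extension_composition_associative
    {E₁ E₂ E₃ E₁₂ E₂₃ E₁₃ : Type*}
    [NormedAddCommGroup E₁] [NormedSpace ℂ E₁] [CompleteSpace E₁]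
    [NormedAddCommGroup E₂] [NormedSpace ℂ E₂] [CompleteSpace E₂]
    [NormedAddCommGroup E₃] [NormedSpace ℂ E₃] [CompleteSpace E₃]
    [NormedAddCommGroup E₁₂] [NormedSpace ℂ E₁₂] [CompleteSpace E₁₂]
    [NormedAddCommGroup E₂₃] [NormedSpace ℂ E₂₃] [CompleteSpace E₂₃]
    [NormedAddCommGroup E₁₃] [NormedSpace ℂ E₁₃] [CompleteSpace E₁₃]
    (m₂₁ : E₂ →L[ℂ] E₁ →L[ℂ] E₁₂) (m₃₂ : E₃ →L[ℂ] E₂ →L[ℂ] E₂₃)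
    (p : E₃ →L[ℂ] E₁₂ →L[ℂ] E₁₃) (q : E₂₃ →L[ℂ] E₁ →L[ℂ] E₁₃)
    (hassoc : ∀ (a : E₁) (b : E₂) (c : E₃), p c (m₂₁ b a) = q (m₃₂ c b) a) :
    ∀ (F : (E₁ →L[ℂ] ℂ) →L[ℂ] ℂ) (G : (E₂ →L[ℂ] ℂ) →L[ℂ] ℂ) (H : (E₃ →L[ℂ] ℂ) →L[ℂ] ℂ),
      arensBL p H (arensBL m₂₁ G F) = arensBL q (arensBL m₃₂ H G) F := by
  intro F G H
  ext f
  change H _ = H _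
  congr 1
  ext c
  change G _ = G _
  congr 1
  ext b
  change F _ = F _
  congr 1
  ext a
  exact congrArg f (hassoc a b c)

end
end

section
/- Let A, B, C, Aᵒ, Bᵒ, Cᵒ be complex Banach spaces with bounded bilinear maps m : B×A → C and n : Aᵒ×Bᵒ → Cᵒ, and bounded conjugate-linear maps * : A → Aᵒ, * : B → Bᵒ, * : C → Cᵒ satisfying (m(b,a))* = n(a*, b*) for all a ∈ A, b ∈ B (as for the involution of a *-linear category, where (g∘f)* = f*∘g*). Extend * to duals and biduals by: for f ∈ (Cᵒ)′, f* ∈ C′ is ⟨f*, c⟩ = conj(⟨f, c*⟩), and for Φ ∈ C″, Φ* ∈ (Cᵒ)″ is ⟨Φ*, f⟩ = conj(⟨Φ, f*⟩) (similarly for A and B). If the Arens extensions m″ and n″ are separately weak*-continuous (Arens regularity), then (m″(G, F))* = n″(F*, G*) for all F ∈ A″ and G ∈ B″. -/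
noncomputable section

open ContinuousLinearMap

/-- A norm-dual element of the bidual `E″`, viewed in the weak-* topology `σ(E″, E′)`. -/
def toWeakStar {E : Type*} [NormedAddCommGroup E] [NormedSpace ℂ E]
    (Φ : (E →L[ℂ] ℂ) →L[ℂ] ℂ) : WeakDual ℂ (E →L[ℂ] ℂ) := Φ

/-- An element of the bidual `E″` carrying the weak-* topology, viewed as a norm-dual
element. -/
def ofWeakStar {E : Type*} [NormedAddCommGroup E] [NormedSpace ℂ E]
    (Φ : WeakDual ℂ (E →L[ℂ] ℂ)) : (E →L[ℂ] ℂ) →L[ℂ] ℂ := Φ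

/-- Arens regularity of a bounded bilinear map: its Arens extension is separately
weak*-continuous. -/
def ArensRegularBL {E F G : Type*}
    [NormedAddCommGroup E] [NormedSpace ℂ E]
    [NormedAddCommGroup F] [NormedSpace ℂ F]
    [NormedAddCommGroup G] [NormedSpace ℂ G]
    (m : F →L[ℂ] E →L[ℂ] G) : Prop :=
  (∀ Φ : (E →L[ℂ] ℂ) →L[ℂ] ℂ,
    Continuous fun Ψ : WeakDual ℂ (F →L[ℂ] ℂ) => toWeakStar (arensBL m (ofWeakStar Ψ) Φ)) ∧
  (∀ Ψ : (F →L[ℂ] ℂ) →L[ℂ] ℂ,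
    Continuous fun Φ : WeakDual ℂ (E →L[ℂ] ℂ) => toWeakStar (arensBL m Ψ (ofWeakStar Φ)))

/-- Complex conjugation as a continuous conjugate-linear map `ℂ → ℂ`. -/
def conjCLM : ℂ →SL[starRingEnd ℂ] ℂ :=
  { toLinearMap :=
      { toFun := fun z => (starRingEnd ℂ) z
        map_add' := fun _ _ => by simp
        map_smul' := fun _ _ => by simp [smul_eq_mul] }
    cont := continuous_star }

@[simp] lemma conjCLM_apply (z : ℂ) : conjCLM z = (starRingEnd ℂ) z := rfl

/-- The extension of a bounded conjugate-linear map `s : X → Y` to duals: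
`f ↦ f*`, where `⟨f*, x⟩ = conj ⟨f, s x⟩` for `f ∈ Y′`. -/
def dualStar {X Y : Type*}
    [NormedAddCommGroup X] [NormedSpace ℂ X]
    [NormedAddCommGroup Y] [NormedSpace ℂ Y]
    (s : X →SL[starRingEnd ℂ] Y) :
    (Y →L[ℂ] ℂ) →SL[starRingEnd ℂ] (X →L[ℂ] ℂ) :=
  LinearMap.mkContinuous
    ({ toFun := fun f => conjCLM.comp (f.comp s)
       map_add' := fun f₁ f₂ => by ext x; simp
       map_smul' := fun c f => by ext x; simp [smul_eq_mul] } :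
      (Y →L[ℂ] ℂ) →ₛₗ[starRingEnd ℂ] (X →L[ℂ] ℂ))
    ‖s‖ (fun f => by
      refine ContinuousLinearMap.opNorm_le_bound _ (by positivity) fun x => ?_
      calc ‖(conjCLM.comp (f.comp s)) x‖ = ‖f (s x)‖ := by simp
        _ ≤ ‖f‖ * ‖s x‖ := f.le_opNorm _
        _ ≤ ‖f‖ * (‖s‖ * ‖x‖) := by gcongr; exact s.le_opNorm x
        _ = ‖s‖ * ‖f‖ * ‖x‖ := by ring)

/-- The extension of a bounded conjugate-linear map `s : X → Y` to biduals:
`Φ ↦ Φ*`, where `⟨Φ*, f⟩ = conj ⟨Φ, f*⟩` for `f ∈ Y′`, `Φ ∈ X″`. -/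
def bidualStar {X Y : Type*}
    [NormedAddCommGroup X] [NormedSpace ℂ X]
    [NormedAddCommGroup Y] [NormedSpace ℂ Y]
    (s : X →SL[starRingEnd ℂ] Y)
    (Φ : (X →L[ℂ] ℂ) →L[ℂ] ℂ) : (Y →L[ℂ] ℂ) →L[ℂ] ℂ :=
  conjCLM.comp (Φ.comp (dualStar s))

theorem arensBL_apply {E F G : Type*}
    [NormedAddCommGroup E] [NormedSpace ℂ E]
    [NormedAddCommGroup F] [NormedSpace ℂ F]
    [NormedAddCommGroup G] [NormedSpace ℂ G]
    (m : F →L[ℂ] E →L[ℂ] G)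
    (Ψ : (F →L[ℂ] ℂ) →L[ℂ] ℂ) (Φ : (E →L[ℂ] ℂ) →L[ℂ] ℂ) (f : G →L[ℂ] ℂ) :
    arensBL m Ψ Φ f = Ψ (Φ.comp ((compL ℂ E G ℂ f).comp m)) := rfl

/-- A weak-* continuous linear functional on a dual space is evaluation at a vector. -/
theorem WeakDual.exists_eq_eval {X : Type*} [NormedAddCommGroup X] [NormedSpace ℂ X]
    (L : WeakDual ℂ X →L[ℂ] ℂ) : ∃ x : X, ∀ Φ : WeakDual ℂ X, L Φ = Φ x := by
  obtain ⟨x, hx⟩ := LinearMap.dualEmbedding_surjective (topDualPairing ℂ X) L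
  exact ⟨x, fun Φ => (DFunLike.congr_fun hx Φ).symm⟩

/-- If the Arens extension is weak-* continuous in its second variable, then it agrees with the
second Arens extension, obtained by evaluating the two bidual elements in the other order. -/
theorem arensBL_apply_eq_of_continuous {E F G : Type*}
    [NormedAddCommGroup E] [NormedSpace ℂ E]
    [NormedAddCommGroup F] [NormedSpace ℂ F]
    [NormedAddCommGroup G] [NormedSpace ℂ G]
    (m : F →L[ℂ] E →L[ℂ] G) (Ψ : (F →L[ℂ] ℂ) →L[ℂ] ℂ)
    (h : Continuous fun Φ : WeakDual ℂ (E →L[ℂ] ℂ) => toWeakStar (arensBL m Ψ (ofWeakStar Φ)))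
    (Φ : (E →L[ℂ] ℂ) →L[ℂ] ℂ) (g : G →L[ℂ] ℂ) :
    arensBL m Ψ Φ g = Φ (Ψ.comp ((compL ℂ F G ℂ g).comp m.flip)) := by
  let L : WeakDual ℂ (E →L[ℂ] ℂ) →L[ℂ] ℂ :=
    { toFun := fun Θ => arensBL m Ψ (ofWeakStar Θ) g
      map_add' := fun Θ₁ Θ₂ => by
        simp only [arensBL_apply]
        rw [← map_add]
        rfl
      map_smul' := fun c Θ => by
        simp only [arensBL_apply]
        rw [RingHom.id_apply, ← map_smul]
        rfl
      cont := (WeakDual.eval_continuous g).comp h }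
  obtain ⟨k, hk⟩ := WeakDual.exists_eq_eval L
  have hL : arensBL m Ψ Φ g = Φ k := hk (toWeakStar Φ)
  rw [hL]
  congr 1
  ext a
  exact (hk (toWeakStar (NormedSpace.inclusionInDoubleDual ℂ E a))).symm

/-- Let `A, B, C, Aᵒ, Bᵒ, Cᵒ` be complex Banach spaces with bounded bilinear maps
`m : B×A → C`, `n : Aᵒ×Bᵒ → Cᵒ` and bounded conjugate-linear maps `* : A → Aᵒ`,
`* : B → Bᵒ`, `* : C → Cᵒ` satisfying `(m(b,a))* = n(a*, b*)` (as for the involution of a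
*-linear category).  If the Arens extensions `m″` and `n″` are separately
weak*-continuous, then `(m″(G, F))* = n″(F*, G*)` for all `F ∈ A″`, `G ∈ B″`. -/
theorem arens_extension_involution
    {A B C Ao Bo Co : Type*}
    [NormedAddCommGroup A] [NormedSpace ℂ A] [CompleteSpace A]
    [NormedAddCommGroup B] [NormedSpace ℂ B] [CompleteSpace B]
    [NormedAddCommGroup C] [NormedSpace ℂ C] [CompleteSpace C]
    [NormedAddCommGroup Ao] [NormedSpace ℂ Ao] [CompleteSpace Ao]
    [NormedAddCommGroup Bo] [NormedSpace ℂ Bo] [CompleteSpace Bo]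
    [NormedAddCommGroup Co] [NormedSpace ℂ Co] [CompleteSpace Co]
    (m : B →L[ℂ] A →L[ℂ] C) (n : Ao →L[ℂ] Bo →L[ℂ] Co)
    (sA : A →SL[starRingEnd ℂ] Ao) (sB : B →SL[starRingEnd ℂ] Bo)
    (sC : C →SL[starRingEnd ℂ] Co)
    (hstar : ∀ (a : A) (b : B), sC (m b a) = n (sA a) (sB b))
    (hm : ArensRegularBL m) (hn : ArensRegularBL n) :
    ∀ (F : (A →L[ℂ] ℂ) →L[ℂ] ℂ) (G : (B →L[ℂ] ℂ) →L[ℂ] ℂ),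
      bidualStar sC (arensBL m G F) = arensBL n (bidualStar sA F) (bidualStar sB G) := by
  intro F G
  ext f
  calc bidualStar sC (arensBL m G F) f
      = conjCLM (arensBL m G F (dualStar sC f)) := rfl
    _ = conjCLM (F (G.comp ((compL ℂ B C ℂ (dualStar sC f)).comp m.flip))) := by
        rw [arensBL_apply_eq_of_continuous m G (hm.2 G)]
    _ = conjCLM (F (dualStar sA ((bidualStar sB G).comp ((compL ℂ Bo Co ℂ f).comp n)))) := by
        congr 2
        ext a
        change G _ = conjCLM (conjCLM (G _))
        rw [conjCLM_apply, conjCLM_apply, Complex.conj_conj]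
        congr 1
        ext b
        exact congrArg (fun c => conjCLM (f c)) (hstar a b)
    _ = arensBL n (bidualStar sA F) (bidualStar sB G) f := rfl

end
end

section
/- Let A₁, A₂, A₃, A₄, A₅, A₆, A₇, A₈ be complex Banach spaces with bounded trilinear maps (linear in the outer, conjugate-linear in the middle variable) t₁ : A₃×A₂×A₁ → A₆, t₂ : A₅×A₄×A₆ → A₈, t₃ : A₅×A₄×A₃ → A₇, t₄ : A₇×A₂×A₁ → A₈, written [h g f] etc., satisfying the associativity law t₂(l, k, t₁(h,g,f)) = t₄(t₃(l,k,h), g, f) for all f ∈ A₁, g ∈ A₂, h ∈ A₃, k ∈ A₄, l ∈ A₅ (as for composition in a linear ternary category). Then the Arens extensions satisfy t₂″(L, K, t₁″(H, G, F)) = t₄″(t₃″(L, K, H), G, F) for all F ∈ A₁″, G ∈ A₂″, H ∈ A₃″, K ∈ A₄″, L ∈ A₅″; that is, [L K [H G F]] = [[L K H] G F]. -/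
set_option maxSynthPendingDepth 2

noncomputable section

open ContinuousLinearMap

variable {A B C D : Type*}
  [NormedAddCommGroup A] [NormedSpace ℂ A]
  [NormedAddCommGroup B] [NormedSpace ℂ B]
  [NormedAddCommGroup C] [NormedSpace ℂ C]
  [NormedAddCommGroup D] [NormedSpace ℂ D]

/-- Evaluation at a vector, for spaces of conjugate-linear continuous maps. -/
def evalSL (g : B) : (B →SL[starRingEnd ℂ] D) →L[ℂ] D :=
  LinearMap.mkContinuous
    { toFun := fun v => v g
      map_add' := fun _ _ => rfl
      map_smul' := fun _ _ => rfl }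
    ‖g‖ (fun v => by rw [mul_comm]; exact v.le_opNorm g)

@[simp] lemma evalSL_apply (g : B) (v : B →SL[starRingEnd ℂ] D) : evalSL g v = v g := rfl

/-- Evaluation at a vector, for spaces of linear continuous maps. -/
def evalL (f : A) : (A →L[ℂ] D) →L[ℂ] D :=
  LinearMap.mkContinuous
    { toFun := fun v => v f
      map_add' := fun _ _ => rfl
      map_smul' := fun _ _ => rfl }
    ‖f‖ (fun v => by rw [mul_comm]; exact v.le_opNorm f)

@[simp] lemma evalL_apply (f : A) (v : A →L[ℂ] D) : evalL f v = v f := rfl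

/-- `μ₀(f',f,g) ∈ C′`, `⟨μ₀(f',f,g), h⟩ = ⟨f', [h g f]⟩`. -/
def mu0 (t : C →L[ℂ] B →SL[starRingEnd ℂ] (A →L[ℂ] D))
    (f' : D →L[ℂ] ℂ) (f : A) (g : B) : C →L[ℂ] ℂ :=
  f'.comp ((evalL f).comp ((evalSL g).comp t))

@[simp] lemma mu0_apply (t : C →L[ℂ] B →SL[starRingEnd ℂ] (A →L[ℂ] D))
    (f' : D →L[ℂ] ℂ) (f : A) (g : B) (h : C) : mu0 t f' f g h = f' (t h g f) := rfl

lemma mu0_norm_le (t : C →L[ℂ] B →SL[starRingEnd ℂ] (A →L[ℂ] D))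
    (f' : D →L[ℂ] ℂ) (f : A) (g : B) :
    ‖mu0 t f' f g‖ ≤ ‖f'‖ * ‖t‖ * ‖f‖ * ‖g‖ := by
  refine opNorm_le_bound _ (by positivity) fun h => ?_
  calc ‖mu0 t f' f g h‖ = ‖f' (t h g f)‖ := rfl
    _ ≤ ‖f'‖ * ‖t h g f‖ := f'.le_opNorm _
    _ ≤ ‖f'‖ * (‖t h g‖ * ‖f‖) := by gcongr; exact (t h g).le_opNorm f
    _ ≤ ‖f'‖ * ((‖t h‖ * ‖g‖) * ‖f‖) := by gcongr; exact (t h).le_opNorm g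
    _ ≤ ‖f'‖ * (((‖t‖ * ‖h‖) * ‖g‖) * ‖f‖) := by gcongr; exact t.le_opNorm h
    _ = ‖f'‖ * ‖t‖ * ‖f‖ * ‖g‖ * ‖h‖ := by ring

variable (t : C →L[ℂ] B →SL[starRingEnd ℂ] (A →L[ℂ] D))

lemma mu0_add_g (f' : D →L[ℂ] ℂ) (f : A) (g₁ g₂ : B) :
    mu0 t f' f (g₁ + g₂) = mu0 t f' f g₁ + mu0 t f' f g₂ := by
  ext h; simp

lemma mu0_smul_g (f' : D →L[ℂ] ℂ) (f : A) (c : ℂ) (g : B) :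
    mu0 t f' f (c • g) = (starRingEnd ℂ) c • mu0 t f' f g := by
  ext h; simp [ContinuousLinearMap.map_smulₛₗ]

lemma mu0_add_f (f' : D →L[ℂ] ℂ) (f₁ f₂ : A) (g : B) :
    mu0 t f' (f₁ + f₂) g = mu0 t f' f₁ g + mu0 t f' f₂ g := by
  ext h; simp

lemma mu0_smul_f (f' : D →L[ℂ] ℂ) (c : ℂ) (f : A) (g : B) :
    mu0 t f' (c • f) g = c • mu0 t f' f g := by
  ext h; simp

lemma mu0_add_f' (f'₁ f'₂ : D →L[ℂ] ℂ) (f : A) (g : B) :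
    mu0 t (f'₁ + f'₂) f g = mu0 t f'₁ f g + mu0 t f'₂ f g := by
  ext h; simp

lemma mu0_smul_f' (c : ℂ) (f' : D →L[ℂ] ℂ) (f : A) (g : B) :
    mu0 t (c • f') f g = c • mu0 t f' f g := by
  ext h; simp

/-- `μ₁(H,f',f) ∈ B′`, `⟨μ₁(H,f',f), g⟩ = conj ⟨H, μ₀(f',f,g)⟩`. -/
def mu1 (H : (C →L[ℂ] ℂ) →L[ℂ] ℂ) (f' : D →L[ℂ] ℂ) (f : A) : B →L[ℂ] ℂ :=
  LinearMap.mkContinuous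
    { toFun := fun g => (starRingEnd ℂ) (H (mu0 t f' f g))
      map_add' := fun g₁ g₂ => by simp [mu0_add_g]
      map_smul' := fun c g => by simp [mu0_smul_g, smul_eq_mul] }
    (‖H‖ * (‖f'‖ * ‖t‖ * ‖f‖))
    (fun g => by
      have h1 : ‖H (mu0 t f' f g)‖ ≤ ‖H‖ * ‖mu0 t f' f g‖ := H.le_opNorm _
      have h2 : ‖H‖ * ‖mu0 t f' f g‖ ≤ ‖H‖ * (‖f'‖ * ‖t‖ * ‖f‖ * ‖g‖) := by
        gcongr
        exact mu0_norm_le t f' f g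
      calc ‖(starRingEnd ℂ) (H (mu0 t f' f g))‖ = ‖H (mu0 t f' f g)‖ := by
            simp
        _ ≤ ‖H‖ * (‖f'‖ * ‖t‖ * ‖f‖ * ‖g‖) := le_trans h1 h2
        _ = ‖H‖ * (‖f'‖ * ‖t‖ * ‖f‖) * ‖g‖ := by ring)

@[simp] lemma mu1_apply (H : (C →L[ℂ] ℂ) →L[ℂ] ℂ) (f' : D →L[ℂ] ℂ) (f : A) (g : B) :
    mu1 t H f' f g = (starRingEnd ℂ) (H (mu0 t f' f g)) := rfl

lemma mu1_norm_le (H : (C →L[ℂ] ℂ) →L[ℂ] ℂ) (f' : D →L[ℂ] ℂ) (f : A) :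
    ‖mu1 t H f' f‖ ≤ ‖H‖ * (‖f'‖ * ‖t‖ * ‖f‖) :=
  LinearMap.mkContinuous_norm_le _ (by positivity) _

lemma mu1_add_f (H : (C →L[ℂ] ℂ) →L[ℂ] ℂ) (f' : D →L[ℂ] ℂ) (f₁ f₂ : A) :
    mu1 t H f' (f₁ + f₂) = mu1 t H f' f₁ + mu1 t H f' f₂ := by
  ext g; simp [mu0_add_f]

lemma mu1_smul_f (H : (C →L[ℂ] ℂ) →L[ℂ] ℂ) (f' : D →L[ℂ] ℂ) (c : ℂ) (f : A) :
    mu1 t H f' (c • f) = (starRingEnd ℂ) c • mu1 t H f' f := by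
  ext g; simp [mu0_smul_f, smul_eq_mul]

lemma mu1_add_f' (H : (C →L[ℂ] ℂ) →L[ℂ] ℂ) (f'₁ f'₂ : D →L[ℂ] ℂ) (f : A) :
    mu1 t H (f'₁ + f'₂) f = mu1 t H f'₁ f + mu1 t H f'₂ f := by
  ext g; simp [mu0_add_f']

lemma mu1_smul_f' (H : (C →L[ℂ] ℂ) →L[ℂ] ℂ) (c : ℂ) (f' : D →L[ℂ] ℂ) (f : A) :
    mu1 t H (c • f') f = (starRingEnd ℂ) c • mu1 t H f' f := by
  ext g; simp [mu0_smul_f', smul_eq_mul]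


/-- `μ₂(G,H,f') ∈ A′`, `⟨μ₂(G,H,f'), f⟩ = conj ⟨G, μ₁(H,f',f)⟩`. -/
def mu2 (G : (B →L[ℂ] ℂ) →L[ℂ] ℂ) (H : (C →L[ℂ] ℂ) →L[ℂ] ℂ) (f' : D →L[ℂ] ℂ) :
    A →L[ℂ] ℂ :=
  LinearMap.mkContinuous
    { toFun := fun f => (starRingEnd ℂ) (G (mu1 t H f' f))
      map_add' := fun f₁ f₂ => by simp [mu1_add_f]
      map_smul' := fun c f => by simp [mu1_smul_f, smul_eq_mul] }
    (‖G‖ * (‖H‖ * (‖f'‖ * ‖t‖)))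
    (fun f => by
      have h1 : ‖G (mu1 t H f' f)‖ ≤ ‖G‖ * ‖mu1 t H f' f‖ := G.le_opNorm _
      have h2 : ‖G‖ * ‖mu1 t H f' f‖ ≤ ‖G‖ * (‖H‖ * (‖f'‖ * ‖t‖ * ‖f‖)) := by
        gcongr
        exact mu1_norm_le t H f' f
      calc ‖(starRingEnd ℂ) (G (mu1 t H f' f))‖ = ‖G (mu1 t H f' f)‖ := by simp
        _ ≤ ‖G‖ * (‖H‖ * (‖f'‖ * ‖t‖ * ‖f‖)) := le_trans h1 h2
        _ = ‖G‖ * (‖H‖ * (‖f'‖ * ‖t‖)) * ‖f‖ := by ring)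

@[simp] lemma mu2_apply (G : (B →L[ℂ] ℂ) →L[ℂ] ℂ) (H : (C →L[ℂ] ℂ) →L[ℂ] ℂ)
    (f' : D →L[ℂ] ℂ) (f : A) :
    mu2 t G H f' f = (starRingEnd ℂ) (G (mu1 t H f' f)) := rfl

lemma mu2_norm_le (G : (B →L[ℂ] ℂ) →L[ℂ] ℂ) (H : (C →L[ℂ] ℂ) →L[ℂ] ℂ) (f' : D →L[ℂ] ℂ) :
    ‖mu2 t G H f'‖ ≤ ‖G‖ * (‖H‖ * (‖f'‖ * ‖t‖)) :=
  LinearMap.mkContinuous_norm_le _ (by positivity) _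

lemma mu2_add_f' (G : (B →L[ℂ] ℂ) →L[ℂ] ℂ) (H : (C →L[ℂ] ℂ) →L[ℂ] ℂ)
    (f'₁ f'₂ : D →L[ℂ] ℂ) :
    mu2 t G H (f'₁ + f'₂) = mu2 t G H f'₁ + mu2 t G H f'₂ := by
  ext f; simp [mu1_add_f']

lemma mu2_smul_f' (G : (B →L[ℂ] ℂ) →L[ℂ] ℂ) (H : (C →L[ℂ] ℂ) →L[ℂ] ℂ)
    (c : ℂ) (f' : D →L[ℂ] ℂ) :
    mu2 t G H (c • f') = c • mu2 t G H f' := by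
  ext f; simp [mu1_smul_f', smul_eq_mul]

/-- The Arens extension `t″ : C″ × B″ × A″ → D″` of the bounded trilinear map `t`,
written `[H G F]`; `⟨[H G F], f'⟩ = ⟨F, μ₂(G,H,f')⟩`. -/
def arens3 (H : (C →L[ℂ] ℂ) →L[ℂ] ℂ) (G : (B →L[ℂ] ℂ) →L[ℂ] ℂ)
    (F : (A →L[ℂ] ℂ) →L[ℂ] ℂ) : (D →L[ℂ] ℂ) →L[ℂ] ℂ :=
  LinearMap.mkContinuous
    { toFun := fun f' => F (mu2 t G H f')
      map_add' := fun f'₁ f'₂ => by simp [mu2_add_f']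
      map_smul' := fun c f' => by simp [mu2_smul_f'] }
    (‖F‖ * (‖G‖ * (‖H‖ * ‖t‖)))
    (fun f' => by
      have h1 : ‖F (mu2 t G H f')‖ ≤ ‖F‖ * ‖mu2 t G H f'‖ := F.le_opNorm _
      have h2 : ‖F‖ * ‖mu2 t G H f'‖ ≤ ‖F‖ * (‖G‖ * (‖H‖ * (‖f'‖ * ‖t‖))) := by
        gcongr
        exact mu2_norm_le t G H f'
      calc ‖F (mu2 t G H f')‖ ≤ ‖F‖ * (‖G‖ * (‖H‖ * (‖f'‖ * ‖t‖))) := le_trans h1 h2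
        _ = ‖F‖ * (‖G‖ * (‖H‖ * ‖t‖)) * ‖f'‖ := by ring)

@[simp] lemma arens3_apply (H : (C →L[ℂ] ℂ) →L[ℂ] ℂ) (G : (B →L[ℂ] ℂ) →L[ℂ] ℂ)
    (F : (A →L[ℂ] ℂ) →L[ℂ] ℂ) (f' : D →L[ℂ] ℂ) :
    arens3 t H G F f' = F (mu2 t G H f') := rfl

/-- Let `A₁,…,A₈` be complex Banach spaces with bounded trilinear maps (linear in the
outer, conjugate-linear in the middle variable) `t₁ : A₃×A₂×A₁ → A₆`,
`t₂ : A₅×A₄×A₆ → A₈`, `t₃ : A₅×A₄×A₃ → A₇`, `t₄ : A₇×A₂×A₁ → A₈`, written `[h g f]`,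
satisfying `[l k [h g f]] = [[l k h] g f]` (as for composition in a linear ternary
category).  Then the Arens extensions satisfy `[L K [H G F]] = [[L K H] G F]`. -/
theorem arens_ternary_composition_associative
    {A₁ A₂ A₃ A₄ A₅ A₆ A₇ A₈ : Type*}
    [NormedAddCommGroup A₁] [NormedSpace ℂ A₁] [CompleteSpace A₁]
    [NormedAddCommGroup A₂] [NormedSpace ℂ A₂] [CompleteSpace A₂]
    [NormedAddCommGroup A₃] [NormedSpace ℂ A₃] [CompleteSpace A₃]
    [NormedAddCommGroup A₄] [NormedSpace ℂ A₄] [CompleteSpace A₄]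
    [NormedAddCommGroup A₅] [NormedSpace ℂ A₅] [CompleteSpace A₅]
    [NormedAddCommGroup A₆] [NormedSpace ℂ A₆] [CompleteSpace A₆]
    [NormedAddCommGroup A₇] [NormedSpace ℂ A₇] [CompleteSpace A₇]
    [NormedAddCommGroup A₈] [NormedSpace ℂ A₈] [CompleteSpace A₈]
    (t₁ : A₃ →L[ℂ] A₂ →SL[starRingEnd ℂ] (A₁ →L[ℂ] A₆))
    (t₂ : A₅ →L[ℂ] A₄ →SL[starRingEnd ℂ] (A₆ →L[ℂ] A₈))
    (t₃ : A₅ →L[ℂ] A₄ →SL[starRingEnd ℂ] (A₃ →L[ℂ] A₇))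
    (t₄ : A₇ →L[ℂ] A₂ →SL[starRingEnd ℂ] (A₁ →L[ℂ] A₈))
    (hassoc : ∀ (f : A₁) (g : A₂) (h : A₃) (k : A₄) (l : A₅),
      t₂ l k (t₁ h g f) = t₄ (t₃ l k h) g f) :
    ∀ (F : (A₁ →L[ℂ] ℂ) →L[ℂ] ℂ) (G : (A₂ →L[ℂ] ℂ) →L[ℂ] ℂ)
      (H : (A₃ →L[ℂ] ℂ) →L[ℂ] ℂ) (K : (A₄ →L[ℂ] ℂ) →L[ℂ] ℂ)
      (L : (A₅ →L[ℂ] ℂ) →L[ℂ] ℂ),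
      arens3 t₂ L K (arens3 t₁ H G F) = arens3 t₄ (arens3 t₃ L K H) G F := by
  intro F G H K L
  have transpose_assoc : ∀ (f' : A₈ →L[ℂ] ℂ) (f : A₁) (g : A₂),
      mu0 t₁ (mu2 t₂ K L f') f g = mu2 t₃ K L (mu0 t₄ f' f g) := by
    intro f' f g
    ext h
    have hmu1 : mu1 t₂ L f' (t₁ h g f) = mu1 t₃ L (mu0 t₄ f' f g) h := by
      ext k
      have hmu0 : mu0 t₂ f' (t₁ h g f) k = mu0 t₃ (mu0 t₄ f' f g) h k := by
        ext l
        simp only [mu0_apply, hassoc]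
      rw [mu1_apply, mu1_apply, hmu0]
    rw [mu0_apply, mu2_apply, mu2_apply, hmu1]
  ext f'
  have hmu2 : mu2 t₁ G H (mu2 t₂ K L f') = mu2 t₄ G (arens3 t₃ L K H) f' := by
    ext f
    have hmu1 : mu1 t₁ H (mu2 t₂ K L f') f = mu1 t₄ (arens3 t₃ L K H) f' f := by
      ext g
      rw [mu1_apply, mu1_apply, transpose_assoc, arens3_apply]
    rw [mu2_apply, mu2_apply, hmu1]
  rw [arens3_apply, arens3_apply, arens3_apply, hmu2]

end
end

section
/- Let A₁,…,A₉ be complex Banach spaces with bounded trilinear maps (linear in the outer, conjugate-linear in the middle variable) t₁ : A₃×A₂×A₁ → A₆, t₂ : A₅×A₄×A₆ → A₈, t₃ : A₅×A₄×A₃ → A₇, t₄ : A₇×A₂×A₁ → A₈, t₅ : A₂×A₃×A₄ → A₉ and t₆ : A₅×A₉×A₁ → A₈, written [· · ·], satisfying elementwise [l k [h g f]] = [l [g h k] f] = [[l k h] g f] for all f ∈ A₁, g ∈ A₂, h ∈ A₃, k ∈ A₄, l ∈ A₅ (the associativity of a linear ternary category). If the Arens extensions of these trilinear maps are separately weak*-continuous,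 then for all F ∈ A₁″, G ∈ A₂″, H ∈ A₃″, K ∈ A₄″, L ∈ A₅″ one has [L K [H G F]] = [L [G H K] F] = [[L K H] G F] in A₈″, where the brackets denote the corresponding Arens extensions. -/
set_option maxSynthPendingDepth 2

noncomputable section

open ContinuousLinearMap

variable {A B C D : Type*}
  [NormedAddCommGroup A] [NormedSpace ℂ A]
  [NormedAddCommGroup B] [NormedSpace ℂ B]
  [NormedAddCommGroup C] [NormedSpace ℂ C]
  [NormedAddCommGroup D] [NormedSpace ℂ D]

variable (t : C →L[ℂ] B →SL[starRingEnd ℂ] (A →L[ℂ] D))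

/-- Separate weak-* continuity of the Arens extension of a bounded trilinear map:
continuity in each of the three variables, the other two being fixed, for the weak-*
topologies `σ(E″, E′)` on the biduals. -/
def SeparatelyWeakStarContinuous
    {A B C D : Type*}
    [NormedAddCommGroup A] [NormedSpace ℂ A]
    [NormedAddCommGroup B] [NormedSpace ℂ B]
    [NormedAddCommGroup C] [NormedSpace ℂ C]
    [NormedAddCommGroup D] [NormedSpace ℂ D]
    (t : C →L[ℂ] B →SL[starRingEnd ℂ] (A →L[ℂ] D)) : Prop :=
  (∀ (H : (C →L[ℂ] ℂ) →L[ℂ] ℂ) (G : (B →L[ℂ] ℂ) →L[ℂ] ℂ),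
    Continuous fun F : WeakDual ℂ (A →L[ℂ] ℂ) =>
      toWeakStar (arens3 t H G (ofWeakStar F))) ∧
  (∀ (H : (C →L[ℂ] ℂ) →L[ℂ] ℂ) (F : (A →L[ℂ] ℂ) →L[ℂ] ℂ),
    Continuous fun G : WeakDual ℂ (B →L[ℂ] ℂ) =>
      toWeakStar (arens3 t H (ofWeakStar G) F)) ∧
  (∀ (G : (B →L[ℂ] ℂ) →L[ℂ] ℂ) (F : (A →L[ℂ] ℂ) →L[ℂ] ℂ),
    Continuous fun H : WeakDual ℂ (C →L[ℂ] ℂ) =>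
      toWeakStar (arens3 t (ofWeakStar H) G F))

section Extension

open NormedSpace

/-- A finite system of equations `⟨x, φ⟩ = ⟨Φ, φ⟩` with `Φ` in the bidual is solvable. -/
lemma exists_forall_apply_eq_bidual {E : Type*} [NormedAddCommGroup E] [NormedSpace ℂ E]
    (Φ : (E →L[ℂ] ℂ) →L[ℂ] ℂ) (s : Finset (E →L[ℂ] ℂ)) :
    ∃ x : E, ∀ φ ∈ s, φ x = Φ φ := by
  classical
  let T : E →ₗ[ℂ] (s → ℂ) := LinearMap.pi fun φ => (φ.1 : E →ₗ[ℂ] ℂ)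
  suffices hmem : (fun φ : s => Φ φ) ∈ LinearMap.range T by
    obtain ⟨x, hx⟩ := hmem
    exact ⟨x, fun φ hφ => congrFun hx ⟨φ, hφ⟩⟩
  by_contra hmem
  obtain ⟨c, hc, hker⟩ := Submodule.exists_le_ker_of_notMem hmem
  have hsum (w : s → ℂ) : c w = ∑ φ, w φ * c (Pi.single φ 1) := by
    rw [LinearMap.pi_apply_eq_sum_univ c w]
    refine Finset.sum_congr rfl fun φ _ => ?_
    rw [smul_eq_mul]
    congr 2
    ext ψ
    simp [Pi.single_apply, eq_comm]
  have hzero : ∑ φ : s, c (Pi.single φ 1) • φ.1 = 0 := by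
    ext x
    have hx : c (T x) = 0 := hker ⟨x, rfl⟩
    rw [hsum] at hx
    simpa [T, mul_comm] using hx
  apply hc
  rw [hsum]
  simpa [mul_comm] using congrArg Φ hzero

/-- A normed space is weak-* dense in its bidual. -/
lemma denseRange_toWeakStar_inclusionInDoubleDual
    (E : Type*) [NormedAddCommGroup E] [NormedSpace ℂ E] :
    DenseRange fun x : E => toWeakStar (inclusionInDoubleDual ℂ E x) := by
  refine dense_iff_inter_open.2 fun U hU ⟨Φ, hΦ⟩ => ?_
  obtain ⟨V, hV, rfl⟩ := isOpen_induced_iff.1 hU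
  obtain ⟨s, u, hu, hsub⟩ := isOpen_pi_iff.1 hV _ hΦ
  obtain ⟨x, hx⟩ := exists_forall_apply_eq_bidual (ofWeakStar Φ) s
  refine ⟨_, hsub fun φ hφ => ?_, x, rfl⟩
  change φ x ∈ u φ
  rw [hx φ hφ]
  exact (hu φ hφ).2

/-- Weak-* continuous maps between biduals are determined by their values on the
original space. -/
lemma eq_of_forall_inclusionInDoubleDual_eq
    {E D : Type*} [NormedAddCommGroup E] [NormedSpace ℂ E]
    [NormedAddCommGroup D] [NormedSpace ℂ D]
    {p q : ((E →L[ℂ] ℂ) →L[ℂ] ℂ) → ((D →L[ℂ] ℂ) →L[ℂ] ℂ)}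
    (hp : Continuous fun Φ : WeakDual ℂ (E →L[ℂ] ℂ) => toWeakStar (p (ofWeakStar Φ)))
    (hq : Continuous fun Φ : WeakDual ℂ (E →L[ℂ] ℂ) => toWeakStar (q (ofWeakStar Φ)))
    (h : ∀ x : E, p (inclusionInDoubleDual ℂ E x) = q (inclusionInDoubleDual ℂ E x))
    (Φ : (E →L[ℂ] ℂ) →L[ℂ] ℂ) : p Φ = q Φ :=
  congrFun ((denseRange_toWeakStar_inclusionInDoubleDual E).equalizer hp hq
    (funext fun x => congrArg toWeakStar (h x))) (toWeakStar Φ)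

/-- The Arens extension extends the original trilinear map. -/
lemma arens3_inclusionInDoubleDual
    {A B C D : Type*}
    [NormedAddCommGroup A] [NormedSpace ℂ A]
    [NormedAddCommGroup B] [NormedSpace ℂ B]
    [NormedAddCommGroup C] [NormedSpace ℂ C]
    [NormedAddCommGroup D] [NormedSpace ℂ D]
    (t : C →L[ℂ] B →SL[starRingEnd ℂ] (A →L[ℂ] D)) (h : C) (g : B) (f : A) :
    arens3 t (inclusionInDoubleDual ℂ C h) (inclusionInDoubleDual ℂ B g)
      (inclusionInDoubleDual ℂ A f) = inclusionInDoubleDual ℂ D (t h g f) := by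
  ext f'
  simp

/-- Separately weak-* continuous maps of five variables on biduals are determined by their
values on the original spaces. -/
lemma eq_of_forall_inclusionInDoubleDual_eq₅
    {A₁ A₂ A₃ A₄ A₅ D : Type*}
    [NormedAddCommGroup A₁] [NormedSpace ℂ A₁]
    [NormedAddCommGroup A₂] [NormedSpace ℂ A₂]
    [NormedAddCommGroup A₃] [NormedSpace ℂ A₃]
    [NormedAddCommGroup A₄] [NormedSpace ℂ A₄]
    [NormedAddCommGroup A₅] [NormedSpace ℂ A₅]
    [NormedAddCommGroup D] [NormedSpace ℂ D]
    {p q : ((A₁ →L[ℂ] ℂ) →L[ℂ] ℂ) → ((A₂ →L[ℂ] ℂ) →L[ℂ] ℂ) → ((A₃ →L[ℂ] ℂ) →L[ℂ] ℂ) →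
      ((A₄ →L[ℂ] ℂ) →L[ℂ] ℂ) → ((A₅ →L[ℂ] ℂ) →L[ℂ] ℂ) → ((D →L[ℂ] ℂ) →L[ℂ] ℂ)}
    (hp₁ : ∀ G H K L, Continuous fun F : WeakDual ℂ (A₁ →L[ℂ] ℂ) =>
      toWeakStar (p (ofWeakStar F) G H K L))
    (hp₂ : ∀ F H K L, Continuous fun G : WeakDual ℂ (A₂ →L[ℂ] ℂ) =>
      toWeakStar (p F (ofWeakStar G) H K L))
    (hp₃ : ∀ F G K L, Continuous fun H : WeakDual ℂ (A₃ →L[ℂ] ℂ) =>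
      toWeakStar (p F G (ofWeakStar H) K L))
    (hp₄ : ∀ F G H L, Continuous fun K : WeakDual ℂ (A₄ →L[ℂ] ℂ) =>
      toWeakStar (p F G H (ofWeakStar K) L))
    (hp₅ : ∀ F G H K, Continuous fun L : WeakDual ℂ (A₅ →L[ℂ] ℂ) =>
      toWeakStar (p F G H K (ofWeakStar L)))
    (hq₁ : ∀ G H K L, Continuous fun F : WeakDual ℂ (A₁ →L[ℂ] ℂ) =>
      toWeakStar (q (ofWeakStar F) G H K L))
    (hq₂ : ∀ F H K L, Continuous fun G : WeakDual ℂ (A₂ →L[ℂ] ℂ) =>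
      toWeakStar (q F (ofWeakStar G) H K L))
    (hq₃ : ∀ F G K L, Continuous fun H : WeakDual ℂ (A₃ →L[ℂ] ℂ) =>
      toWeakStar (q F G (ofWeakStar H) K L))
    (hq₄ : ∀ F G H L, Continuous fun K : WeakDual ℂ (A₄ →L[ℂ] ℂ) =>
      toWeakStar (q F G H (ofWeakStar K) L))
    (hq₅ : ∀ F G H K, Continuous fun L : WeakDual ℂ (A₅ →L[ℂ] ℂ) =>
      toWeakStar (q F G H K (ofWeakStar L)))
    (hpq : ∀ (f : A₁) (g : A₂) (h : A₃) (k : A₄) (l : A₅),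
      p (inclusionInDoubleDual ℂ A₁ f) (inclusionInDoubleDual ℂ A₂ g)
        (inclusionInDoubleDual ℂ A₃ h) (inclusionInDoubleDual ℂ A₄ k)
        (inclusionInDoubleDual ℂ A₅ l) =
      q (inclusionInDoubleDual ℂ A₁ f) (inclusionInDoubleDual ℂ A₂ g)
        (inclusionInDoubleDual ℂ A₃ h) (inclusionInDoubleDual ℂ A₄ k)
        (inclusionInDoubleDual ℂ A₅ l))
    (F : (A₁ →L[ℂ] ℂ) →L[ℂ] ℂ) (G : (A₂ →L[ℂ] ℂ) →L[ℂ] ℂ) (H : (A₃ →L[ℂ] ℂ) →L[ℂ] ℂ)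
    (K : (A₄ →L[ℂ] ℂ) →L[ℂ] ℂ) (L : (A₅ →L[ℂ] ℂ) →L[ℂ] ℂ) :
    p F G H K L = q F G H K L := by
  refine eq_of_forall_inclusionInDoubleDual_eq (p := fun F => p F G H K L)
    (q := fun F => q F G H K L) (hp₁ G H K L) (hq₁ G H K L) (fun f => ?_) F
  refine eq_of_forall_inclusionInDoubleDual_eq (p := fun G => p _ G H K L)
    (q := fun G => q _ G H K L) (hp₂ _ H K L) (hq₂ _ H K L) (fun g => ?_) G
  refine eq_of_forall_inclusionInDoubleDual_eq (p := fun H => p _ _ H K L)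
    (q := fun H => q _ _ H K L) (hp₃ _ _ K L) (hq₃ _ _ K L) (fun h => ?_) H
  refine eq_of_forall_inclusionInDoubleDual_eq (p := fun K => p _ _ _ K L)
    (q := fun K => q _ _ _ K L) (hp₄ _ _ _ L) (hq₄ _ _ _ L) (fun k => ?_) K
  exact eq_of_forall_inclusionInDoubleDual_eq (p := fun L => p _ _ _ _ L)
    (q := fun L => q _ _ _ _ L) (hp₅ _ _ _ _) (hq₅ _ _ _ _) (fun l => hpq f g h k l) L

end Extension

/-- Let `A₁,…,A₉` be complex Banach spaces with bounded trilinear maps (linear in the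
outer, conjugate-linear in the middle variable) `t₁ : A₃×A₂×A₁ → A₆`,
`t₂ : A₅×A₄×A₆ → A₈`, `t₃ : A₅×A₄×A₃ → A₇`, `t₄ : A₇×A₂×A₁ → A₈`, `t₅ : A₂×A₃×A₄ → A₉`,
`t₆ : A₅×A₉×A₁ → A₈`, satisfying elementwise
`[l k [h g f]] = [l [g h k] f] = [[l k h] g f]` (the associativity of a linear ternary
category).  If the Arens extensions of these trilinear maps are separately
weak*-continuous, then `[L K [H G F]] = [L [G H K] F] = [[L K H] G F]` in `A₈″`. -/
theorem arens_ternary_full_associativity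
    {A₁ A₂ A₃ A₄ A₅ A₆ A₇ A₈ A₉ : Type*}
    [NormedAddCommGroup A₁] [NormedSpace ℂ A₁] [CompleteSpace A₁]
    [NormedAddCommGroup A₂] [NormedSpace ℂ A₂] [CompleteSpace A₂]
    [NormedAddCommGroup A₃] [NormedSpace ℂ A₃] [CompleteSpace A₃]
    [NormedAddCommGroup A₄] [NormedSpace ℂ A₄] [CompleteSpace A₄]
    [NormedAddCommGroup A₅] [NormedSpace ℂ A₅] [CompleteSpace A₅]
    [NormedAddCommGroup A₆] [NormedSpace ℂ A₆] [CompleteSpace A₆]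
    [NormedAddCommGroup A₇] [NormedSpace ℂ A₇] [CompleteSpace A₇]
    [NormedAddCommGroup A₈] [NormedSpace ℂ A₈] [CompleteSpace A₈]
    [NormedAddCommGroup A₉] [NormedSpace ℂ A₉] [CompleteSpace A₉]
    (t₁ : A₃ →L[ℂ] A₂ →SL[starRingEnd ℂ] (A₁ →L[ℂ] A₆))
    (t₂ : A₅ →L[ℂ] A₄ →SL[starRingEnd ℂ] (A₆ →L[ℂ] A₈))
    (t₃ : A₅ →L[ℂ] A₄ →SL[starRingEnd ℂ] (A₃ →L[ℂ] A₇))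
    (t₄ : A₇ →L[ℂ] A₂ →SL[starRingEnd ℂ] (A₁ →L[ℂ] A₈))
    (t₅ : A₂ →L[ℂ] A₃ →SL[starRingEnd ℂ] (A₄ →L[ℂ] A₉))
    (t₆ : A₅ →L[ℂ] A₉ →SL[starRingEnd ℂ] (A₁ →L[ℂ] A₈))
    (hassoc₁ : ∀ (f : A₁) (g : A₂) (h : A₃) (k : A₄) (l : A₅),
      t₂ l k (t₁ h g f) = t₆ l (t₅ g h k) f)
    (hassoc₂ : ∀ (f : A₁) (g : A₂) (h : A₃) (k : A₄) (l : A₅),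
      t₂ l k (t₁ h g f) = t₄ (t₃ l k h) g f)
    (h₁ : SeparatelyWeakStarContinuous t₁) (h₂ : SeparatelyWeakStarContinuous t₂)
    (h₃ : SeparatelyWeakStarContinuous t₃) (h₄ : SeparatelyWeakStarContinuous t₄)
    (h₅ : SeparatelyWeakStarContinuous t₅) (h₆ : SeparatelyWeakStarContinuous t₆) :
    ∀ (F : (A₁ →L[ℂ] ℂ) →L[ℂ] ℂ) (G : (A₂ →L[ℂ] ℂ) →L[ℂ] ℂ)
      (H : (A₃ →L[ℂ] ℂ) →L[ℂ] ℂ) (K : (A₄ →L[ℂ] ℂ) →L[ℂ] ℂ)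
      (L : (A₅ →L[ℂ] ℂ) →L[ℂ] ℂ),
      arens3 t₂ L K (arens3 t₁ H G F) = arens3 t₆ L (arens3 t₅ G H K) F ∧
      arens3 t₂ L K (arens3 t₁ H G F) = arens3 t₄ (arens3 t₃ L K H) G F := by
  intro F G H K L
  constructor
  · refine eq_of_forall_inclusionInDoubleDual_eq₅
      (p := fun F G H K L => arens3 t₂ L K (arens3 t₁ H G F))
      (q := fun F G H K L => arens3 t₆ L (arens3 t₅ G H K) F)
      (fun G H K L => (h₂.1 L K).comp (h₁.1 H G))
      (fun F H K L => (h₂.1 L K).comp (h₁.2.1 H F))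
      (fun F G K L => (h₂.1 L K).comp (h₁.2.2 G F))
      (fun F G H L => h₂.2.1 L _)
      (fun F G H K => h₂.2.2 K _)
      (fun G H K L => h₆.1 L _)
      (fun F H K L => (h₆.2.1 L F).comp (h₅.2.2 H K))
      (fun F G K L => (h₆.2.1 L F).comp (h₅.2.1 G K))
      (fun F G H L => (h₆.2.1 L F).comp (h₅.1 G H))
      (fun F G H K => h₆.2.2 _ F) (fun f g h k l => ?_) F G H K L
    simp only [arens3_inclusionInDoubleDual, hassoc₁]
  · refine eq_of_forall_inclusionInDoubleDual_eq₅
      (p := fun F G H K L => arens3 t₂ L K (arens3 t₁ H G F))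
      (q := fun F G H K L => arens3 t₄ (arens3 t₃ L K H) G F)
      (fun G H K L => (h₂.1 L K).comp (h₁.1 H G))
      (fun F H K L => (h₂.1 L K).comp (h₁.2.1 H F))
      (fun F G K L => (h₂.1 L K).comp (h₁.2.2 G F))
      (fun F G H L => h₂.2.1 L _)
      (fun F G H K => h₂.2.2 K _)
      (fun G H K L => h₄.1 _ G)
      (fun F H K L => h₄.2.1 _ F)
      (fun F G K L => (h₄.2.2 G F).comp (h₃.1 L K))
      (fun F G H L => (h₄.2.2 G F).comp (h₃.2.1 L H))
      (fun F G H K => (h₄.2.2 G F).comp (h₃.2.2 K H)) (fun f g h k l => ?_) F G H K L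
    simp only [arens3_inclusionInDoubleDual, hassoc₂]

end
end

section
/- Let Z be a C*-ternary ring. Then the triple product of Z is Arens regular: its Arens extension t″ : Z″×Z″×Z″ → Z″ to the bidual is separately weak*-continuous, i.e. continuous in each of the three variables (the other two being fixed) for the weak-* topology σ(Z″, Z′) on Z″. -/
set_option maxSynthPendingDepth 2

noncomputable section

open ContinuousLinearMap

variable {A B C D : Type*}
  [NormedAddCommGroup A] [NormedSpace ℂ A]
  [NormedAddCommGroup B] [NormedSpace ℂ B]
  [NormedAddCommGroup C] [NormedSpace ℂ C]
  [NormedAddCommGroup D] [NormedSpace ℂ D]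

variable (t : C →L[ℂ] B →SL[starRingEnd ℂ] (A →L[ℂ] D))

/-- A bounded bilinear form is Arens regular if its two Arens extensions to the biduals agree. -/
def IsArensRegularForm {X Y : Type*} [NormedAddCommGroup X] [NormedSpace ℂ X]
    [NormedAddCommGroup Y] [NormedSpace ℂ Y] (Φ : X →L[ℂ] Y →L[ℂ] ℂ) : Prop :=
  ∀ (F : (Y →L[ℂ] ℂ) →L[ℂ] ℂ) (G : (X →L[ℂ] ℂ) →L[ℂ] ℂ), F (G.comp Φ.flip) = G (F.comp Φ)

namespace IsArensRegularForm

variable {X Y : Type*} [NormedAddCommGroup X] [NormedSpace ℂ X]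
  [NormedAddCommGroup Y] [NormedSpace ℂ Y] {Φ Ψ : X →L[ℂ] Y →L[ℂ] ℂ}

lemma add (hΦ : IsArensRegularForm Φ) (hΨ : IsArensRegularForm Ψ) :
    IsArensRegularForm (Φ + Ψ) := by
  intro F G
  have h₁ : G.comp (Φ + Ψ).flip = G.comp Φ.flip + G.comp Ψ.flip := by ext; simp
  have h₂ : F.comp (Φ + Ψ) = F.comp Φ + F.comp Ψ := by ext; simp
  rw [h₁, h₂, map_add, map_add, hΦ, hΨ]

lemma smul (c : ℂ) (hΦ : IsArensRegularForm Φ) : IsArensRegularForm (c • Φ) := by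
  intro F G
  have h₁ : G.comp (c • Φ).flip = c • G.comp Φ.flip := by ext; simp
  have h₂ : F.comp (c • Φ) = c • F.comp Φ := by ext; simp
  rw [h₁, h₂, map_smul, map_smul, hΦ]

/-- A bilinear form that factors through a Hilbert space is Arens regular. -/
lemma of_factors {E : Type*} [NormedAddCommGroup E] [InnerProductSpace ℂ E] [CompleteSpace E]
    (J : X →L[ℂ] E →L[ℂ] ℂ) (K : Y →L[ℂ] E) (h : ∀ x y, Φ x y = J x (K y)) :
    IsArensRegularForm Φ := by
  intro F G
  let α : E →L[ℂ] ℂ := LinearMap.mkContinuous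
    { toFun := fun e => (starRingEnd ℂ) (F ((innerSL ℂ e).comp K))
      map_add' := fun e₁ e₂ => by simp [add_comp]
      map_smul' := fun c e => by simp [smul_comp] }
    (‖F‖ * ‖K‖) (fun e => by
      have h1 := F.le_opNorm ((innerSL ℂ e).comp K)
      have h2 := (innerSL ℂ e).opNorm_comp_le K
      rw [innerSL_apply_norm] at h2
      calc ‖(starRingEnd ℂ) (F ((innerSL ℂ e).comp K))‖ = ‖F ((innerSL ℂ e).comp K)‖ := by simp
        _ ≤ ‖F‖ * (‖e‖ * ‖K‖) := h1.trans (by gcongr)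
        _ = ‖F‖ * ‖K‖ * ‖e‖ := by ring)
  let k : E := (InnerProductSpace.toDual ℂ E).symm α
  have hk : ∀ l : E →L[ℂ] ℂ, F (l.comp K) = l k := by
    intro l
    obtain ⟨e, rfl⟩ := (InnerProductSpace.toDual ℂ E).surjective l
    have h1 : inner ℂ k e = α e := InnerProductSpace.toDual_symm_apply
    have h2 : α e = (starRingEnd ℂ) (F ((innerSL ℂ e).comp K)) := rfl
    rw [InnerProductSpace.toDual_apply_apply, ← inner_conj_symm, h1, h2, Complex.conj_conj]
    rfl
  have h₁ : G.comp Φ.flip = (G.comp J.flip).comp K := by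
    ext y
    simp only [comp_apply]
    congr 1
    ext x
    simp [h]
  have h₂ : F.comp Φ = J.flip k := by
    ext x
    rw [comp_apply, flip_apply, ← hk]
    congr 1
    ext y
    simp [h]
  rw [h₁, h₂, hk]
  rfl

end IsArensRegularForm

/-- The bilinear form `(a, b) ↦ ω (a * b)`. -/
def mulForm {𝔄 : Type*} [NormedRing 𝔄] [NormedAlgebra ℂ 𝔄] (ω : 𝔄 →L[ℂ] ℂ) :
    𝔄 →L[ℂ] 𝔄 →L[ℂ] ℂ :=
  (compL ℂ 𝔄 𝔄 ℂ ω).comp (ContinuousLinearMap.mul ℂ 𝔄)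

@[simp] lemma mulForm_apply {𝔄 : Type*} [NormedRing 𝔄] [NormedAlgebra ℂ 𝔄] (ω : 𝔄 →L[ℂ] ℂ)
    (a b : 𝔄) : mulForm ω a b = ω (a * b) := rfl

section Order

open scoped ComplexOrder ComplexStarModule

variable {𝔄 : Type*} [CStarAlgebra 𝔄] [PartialOrder 𝔄] [StarOrderedRing 𝔄]

lemma isArensRegularForm_mulForm_of_nonneg (ω : 𝔄 →L[ℂ] ℂ) (hω : ∀ p : 𝔄, 0 ≤ p → 0 ≤ ω p) :
    IsArensRegularForm (mulForm ω) := by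
  let f : 𝔄 →ₚ[ℂ] ℂ := PositiveLinearMap.mk₀ ω.toLinearMap hω
  let K₀ : 𝔄 →L[ℂ] f.PreGNS := f.toPreGNS.toLinearMap.mkContinuous ‖f.toPreGNS 1‖ fun a => by
    have h1 : f.toPreGNS a = f.leftMulMapPreGNS a (f.toPreGNS 1) := by simp
    have h2 : ‖f.leftMulMapPreGNS a‖ ≤ ‖a‖ := LinearMap.mkContinuous_norm_le _ (norm_nonneg _) _
    calc ‖f.toPreGNS a‖ ≤ ‖f.leftMulMapPreGNS a‖ * ‖f.toPreGNS 1‖ := by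
          rw [h1]; exact le_opNorm _ _
      _ ≤ ‖f.toPreGNS 1‖ * ‖a‖ := by rw [mul_comm]; gcongr
  let K : 𝔄 →L[ℂ] f.GNS := UniformSpace.Completion.toComplL.comp K₀
  let J : 𝔄 →L[ℂ] f.GNS →L[ℂ] ℂ :=
    (innerSL ℂ).comp (K.comp (starL ℂ (A := 𝔄) : 𝔄 →L⋆[ℂ] 𝔄))
  refine IsArensRegularForm.of_factors J K fun a b => ?_
  have : J a (K b) = inner ℂ (f.toPreGNS (star a)) (f.toPreGNS b) :=
    UniformSpace.Completion.inner_coe _ _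
  rw [this, PositiveLinearMap.preGNS_inner_def]
  simp [f]
  rfl

/-- Hahn-Banach: the real part of a bounded functional is dominated, on the positive cone, by a
positive real functional. -/
lemma exists_nonneg_real_ge (ω : 𝔄 →L[ℂ] ℂ) : ∃ Λ : 𝔄 →ₗ[ℝ] ℝ,
    ∀ p : 𝔄, 0 ≤ p → 0 ≤ Λ p ∧ (ω p).re ≤ Λ p := by
  let v : 𝔄 → {p : 𝔄 // 0 ≤ p} × {p : 𝔄 // 0 ≤ p} → ℝ := fun x q =>
    ‖ω‖ * ‖x + q.1 + q.2‖ - (ω q.2).re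
  let N : 𝔄 → ℝ := fun x => ⨅ q, v x q
  have : Nonempty ({p : 𝔄 // 0 ≤ p} × {p : 𝔄 // 0 ≤ p}) := ⟨⟨0, le_rfl⟩, ⟨0, le_rfl⟩⟩
  have hbdd : ∀ x q, -(‖ω‖ * ‖x‖) ≤ v x q := by
    rintro x ⟨⟨c, hc⟩, ⟨d, hd⟩⟩
    have h1 : (ω d).re ≤ ‖ω‖ * ‖d‖ := (Complex.re_le_norm _).trans (ω.le_opNorm d)
    have h2 : ‖d‖ ≤ ‖c + d‖ :=
      CStarAlgebra.norm_le_norm_of_nonneg_of_le hd (le_add_of_nonneg_left hc)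
    have h3 : ‖c + d‖ ≤ ‖x + c + d‖ + ‖x‖ := by
      have : c + d = (x + c + d) - x := by abel
      rw [this]; exact norm_sub_le _ _
    have h4 : ‖ω‖ * ‖d‖ ≤ ‖ω‖ * (‖x + c + d‖ + ‖x‖) := by
      gcongr; exact h2.trans h3
    simp only [v]
    linarith
  have hN : ∀ x q, N x ≤ v x q := fun x q => ciInf_le ⟨_, by rintro _ ⟨q, rfl⟩; exact hbdd x q⟩ q
  have hsmul : ∀ c : ℝ, 0 < c → ∀ x, N (c • x) ≤ c * N x := by
    intro c hc x
    rw [Real.mul_iInf_of_nonneg hc.le]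
    refine le_ciInf fun q => ?_
    refine (hN _ (⟨c • q.1, smul_nonneg hc.le q.1.2⟩, ⟨c • q.2, smul_nonneg hc.le q.2.2⟩)).trans ?_
    have h1 : c • x + c • (q.1 : 𝔄) + c • (q.2 : 𝔄) = c • (x + q.1 + q.2) := by
      simp [smul_add]
    have h2 : ω (c • (q.2 : 𝔄)) = c * ω q.2 := by
      rw [← Complex.coe_smul, map_smul, smul_eq_mul]
    simp only [v, h1, h2, norm_smul, Real.norm_of_nonneg hc.le, Complex.re_ofReal_mul]
    exact le_of_eq (by ring)
  have hhom : ∀ c : ℝ, 0 < c → ∀ x, N (c • x) = c * N x := by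
    intro c hc x
    refine le_antisymm (hsmul c hc x) ?_
    have h := hsmul c⁻¹ (inv_pos.mpr hc) (c • x)
    rw [smul_smul, inv_mul_cancel₀ hc.ne', one_smul] at h
    calc c * N x ≤ c * (c⁻¹ * N (c • x)) := by gcongr
      _ = N (c • x) := by field_simp
  have hadd : ∀ x y, N (x + y) ≤ N x + N y := by
    intro x y
    refine le_ciInf_add_ciInf fun q r => ?_
    refine (hN _ (⟨q.1 + r.1, add_nonneg q.1.2 r.1.2⟩, ⟨q.2 + r.2, add_nonneg q.2.2 r.2.2⟩)).trans ?_
    have h1 : x + y + ((q.1 : 𝔄) + r.1) + ((q.2 : 𝔄) + r.2) = (x + q.1 + q.2) + (y + r.1 + r.2) := by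
      abel
    have h2 : ‖ω‖ * ‖(x + q.1 + q.2) + (y + r.1 + r.2)‖
        ≤ ‖ω‖ * (‖x + q.1 + q.2‖ + ‖y + r.1 + r.2‖) := by
      gcongr; exact norm_add_le _ _
    simp only [v, h1, map_add, Complex.add_re]
    linarith
  obtain ⟨Λ, -, hΛ⟩ := exists_extension_of_le_sublinear
    (⟨⊥, 0⟩ : 𝔄 →ₗ.[ℝ] ℝ) N hhom hadd (by
      rintro ⟨x, hx⟩
      obtain rfl := (Submodule.mem_bot ℝ).mp hx
      have h := hhom 2 two_pos 0
      rw [smul_zero] at h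
      have h0 : N 0 = 0 := by linarith
      simp [h0])
  refine ⟨Λ, fun p hp => ⟨?_, ?_⟩⟩
  · have h := (hΛ (-p)).trans (hN (-p) (⟨p, hp⟩, ⟨0, le_rfl⟩))
    simp [v] at h
    exact h
  · have h := (hΛ (-p)).trans (hN (-p) (⟨0, le_rfl⟩, ⟨p, hp⟩))
    simp [v] at h
    exact h

lemma isArensRegularForm_mulForm_of_hermitian (ω : 𝔄 →L[ℂ] ℂ)
    (hω : ∀ a, ω (star a) = (starRingEnd ℂ) (ω a)) : IsArensRegularForm (mulForm ω) := by
  obtain ⟨Λ, hΛ⟩ := exists_nonneg_real_ge ω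
  let f₀ : 𝔄 →ₗ[ℂ] ℂ :=
    { toFun := fun a => Λ (ℜ a : 𝔄) + Complex.I * Λ (ℑ a : 𝔄)
      map_add' := fun a b => by simp; ring
      map_smul' := fun c a => by
        apply Complex.ext <;> simp [realPart_smul, imaginaryPart_smul] }
  have hf₀ : ∀ p : 𝔄, 0 ≤ p → f₀ p = Λ p := by
    intro p hp
    have hsa : IsSelfAdjoint p := .of_nonneg hp
    simp [f₀, hsa.coe_realPart, hsa.imaginaryPart]
  have hf₀_nonneg : ∀ p : 𝔄, 0 ≤ p → 0 ≤ f₀ p := by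
    intro p hp
    rw [hf₀ p hp]
    exact_mod_cast (hΛ p hp).1
  obtain ⟨M, hM⟩ := (PositiveLinearMap.mk₀ f₀ hf₀_nonneg).exists_norm_apply_le
  let f : 𝔄 →L[ℂ] ℂ := f₀.mkContinuous M hM
  have hf : IsArensRegularForm (mulForm f) := isArensRegularForm_mulForm_of_nonneg f hf₀_nonneg
  have hfω : IsArensRegularForm (mulForm (f - ω)) := by
    refine isArensRegularForm_mulForm_of_nonneg _ fun p hp => ?_
    have hsa : IsSelfAdjoint p := .of_nonneg hp
    have him : ω p = ((ω p).re : ℂ) := by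
      have h := hω p
      rw [hsa.star_eq] at h
      exact (Complex.conj_eq_iff_re.mp h.symm).symm
    have h1 : (f - ω) p = ((Λ p - (ω p).re : ℝ) : ℂ) := by
      rw [sub_apply, him, Complex.ofReal_sub]
      exact congrArg (· - _) (hf₀ p hp)
    rw [h1]
    exact_mod_cast sub_nonneg.mpr (hΛ p hp).2
  have h : mulForm ω = mulForm f + (-1 : ℂ) • mulForm (f - ω) := by
    ext a b; simp
  rw [h]
  exact hf.add (hfω.smul _)

end Order

/-- On a C*-algebra, every bounded functional composed with the product is Arens regular. -/
theorem isArensRegularForm_mulForm {𝔄 : Type*} [CStarAlgebra 𝔄] (ω : 𝔄 →L[ℂ] ℂ) :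
    IsArensRegularForm (mulForm ω) := by
  let := CStarAlgebra.spectralOrder 𝔄
  have := CStarAlgebra.spectralOrderedRing 𝔄
  let ω' : 𝔄 →L[ℂ] ℂ := LinearMap.mkContinuous
    { toFun := fun a => (starRingEnd ℂ) (ω (star a))
      map_add' := fun a b => by simp
      map_smul' := fun c a => by simp } ‖ω‖ (fun a => by
        simpa using ω.le_opNorm (star a))
  have hω' : ∀ a, ω' a = (starRingEnd ℂ) (ω (star a)) := fun _ => rfl
  have h₁ := isArensRegularForm_mulForm_of_hermitian (ω + ω') fun a => by
    rw [add_apply, add_apply, hω', hω', star_star, map_add, Complex.conj_conj, add_comm]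
  have h₂ := isArensRegularForm_mulForm_of_hermitian (Complex.I • (ω - ω')) fun a => by
    simp only [smul_apply, sub_apply, hω', star_star, smul_eq_mul, map_mul, map_sub,
      Complex.conj_I, Complex.conj_conj]
    ring
  have h : mulForm ω = (2⁻¹ : ℂ) • mulForm (ω + ω') +
      (-Complex.I / 2) • mulForm (Complex.I • (ω - ω')) := by
    ext a b
    simp only [add_apply, smul_apply, sub_apply, mulForm_apply, smul_eq_mul]
    linear_combination (1 / 2 * (ω (a * b) - ω' (a * b))) * Complex.I_mul_I
  rw [h]
  exact (h₁.smul _).add (h₂.smul _)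

/-- The conjugate of a complex normed space. -/
def ConjSpace (Z : Type*) := Z

namespace ConjSpace

variable {Z : Type*} [NormedAddCommGroup Z]

instance : NormedAddCommGroup (ConjSpace Z) := inferInstanceAs (NormedAddCommGroup Z)

instance [CompleteSpace Z] : CompleteSpace (ConjSpace Z) := inferInstanceAs (CompleteSpace Z)

variable [NormedSpace ℂ Z]

instance : Module ℂ (ConjSpace Z) := Module.compHom Z (starRingEnd ℂ)

instance : NormedSpace ℂ (ConjSpace Z) where
  norm_smul_le c z := by
    have h : ‖c • z‖ = ‖(starRingEnd ℂ c) • (show Z from z)‖ := rfl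
    rw [h, norm_smul, RCLike.norm_conj]
    rfl

/-- The identity map, as a conjugate-linear isometry onto the conjugate space. -/
def toConj : Z ≃ₗᵢ⋆[ℂ] ConjSpace Z where
  toFun z := z
  invFun z := z
  map_add' _ _ := rfl
  map_smul' c z := by
    have h : (starRingEnd ℂ (starRingEnd ℂ c)) • z = c • z := by rw [Complex.conj_conj]
    exact h.symm
  left_inv _ := rfl
  right_inv _ := rfl
  norm_map' _ := rfl

/-- An operator, seen as an operator on the conjugate space. -/
def conjMap (f : Z →L[ℂ] Z) : ConjSpace Z →L[ℂ] ConjSpace Z :=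
  (toConj (Z := Z) : Z →L⋆[ℂ] ConjSpace Z).comp
    (f.comp ((toConj (Z := Z)).symm : ConjSpace Z →L⋆[ℂ] Z))

/-- An operator on the conjugate space, seen as an operator. -/
def unconjMap (f : ConjSpace Z →L[ℂ] ConjSpace Z) : Z →L[ℂ] Z :=
  ((toConj (Z := Z)).symm : ConjSpace Z →L⋆[ℂ] Z).comp
    (f.comp (toConj (Z := Z) : Z →L⋆[ℂ] ConjSpace Z))

lemma norm_conjMap_le (f : Z →L[ℂ] Z) : ‖conjMap f‖ ≤ ‖f‖ :=
  opNorm_le_bound _ (norm_nonneg _) fun z => f.le_opNorm (toConj.symm z)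

lemma norm_unconjMap (f : ConjSpace Z →L[ℂ] ConjSpace Z) : ‖unconjMap f‖ = ‖f‖ :=
  le_antisymm (opNorm_le_bound _ (norm_nonneg _) fun z => f.le_opNorm (toConj z))
    (norm_conjMap_le (unconjMap f))

end ConjSpace

section Ternary

open ConjSpace MulOpposite

/-- The axioms of a C*-ternary ring, for a bounded triple product. -/
structure IsCStarTernary {Z : Type*} [NormedAddCommGroup Z] [NormedSpace ℂ Z]
    (T : Z →L[ℂ] Z →SL[starRingEnd ℂ] (Z →L[ℂ] Z)) : Prop where
  assoc_mid : ∀ v w x y z : Z, T (T v w x) y z = T v (T y x w) z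
  assoc_right : ∀ v w x y z : Z, T (T v w x) y z = T v w (T x y z)
  norm_le : ∀ x y z : Z, ‖T x y z‖ ≤ ‖x‖ * ‖y‖ * ‖z‖
  norm_cube : ∀ x : Z, ‖T x x x‖ = ‖x‖ ^ 3

variable {Z : Type*} [NormedAddCommGroup Z] [NormedSpace ℂ Z]

/-- The relation `[h (f w) x] = [h w (g x)]` for all `h`, `w`, `x`. -/
def IsTernaryAdjoint (T : Z →L[ℂ] Z →SL[starRingEnd ℂ] (Z →L[ℂ] Z)) (f g : Z →L[ℂ] Z) : Prop :=
  ∀ h w x, T h (f w) x = T h w (g x)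

/-- The pairs `(f, g)` of operators on `Z` that are adjoint to each other with respect to the
triple product. -/
def adjointPairs (T : Z →L[ℂ] Z →SL[starRingEnd ℂ] (Z →L[ℂ] Z)) :
    Subalgebra ℂ ((Z →L[ℂ] Z) × (ConjSpace Z →L[ℂ] ConjSpace Z)ᵐᵒᵖ) where
  carrier := {p | IsTernaryAdjoint T p.1 (unconjMap p.2.unop) ∧
    IsTernaryAdjoint T (unconjMap p.2.unop) p.1}
  mul_mem' := by
    rintro p q ⟨hp₁, hp₂⟩ ⟨hq₁, hq₂⟩
    refine ⟨fun h w x => ?_, fun h w x => ?_⟩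
    · exact (hp₁ h (q.1 w) x).trans (hq₁ h w _)
    · exact (hq₂ h (unconjMap p.2.unop w) x).trans (hp₂ h w _)
  add_mem' := by
    rintro p q ⟨hp₁, hp₂⟩ ⟨hq₁, hq₂⟩
    refine ⟨fun h w x => ?_, fun h w x => ?_⟩
    · have e : unconjMap (p + q).2.unop x = unconjMap p.2.unop x + unconjMap q.2.unop x := rfl
      rw [e, map_add, ← hp₁ h w x, ← hq₁ h w x, ← add_apply, ← map_add]
      rfl
    · have e : unconjMap (p + q).2.unop w = unconjMap p.2.unop w + unconjMap q.2.unop w := rfl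
      rw [e, map_add, add_apply, hp₂ h w x, hq₂ h w x, ← map_add]
      rfl
  algebraMap_mem' := by
    intro c
    have e : ∀ x, unconjMap (algebraMap ℂ ((Z →L[ℂ] Z) × (ConjSpace Z →L[ℂ] ConjSpace Z)ᵐᵒᵖ)
        c).2.unop x = (starRingEnd ℂ c) • x := fun x => rfl
    have e' : ∀ x, (algebraMap ℂ ((Z →L[ℂ] Z) × (ConjSpace Z →L[ℂ] ConjSpace Z)ᵐᵒᵖ)
        c).1 x = c • x := fun x => rfl
    refine ⟨fun h w x => ?_, fun h w x => ?_⟩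
    · rw [e, e', map_smulₛₗ, smul_apply, map_smul]
    · rw [e, e', map_smulₛₗ, smul_apply, map_smul, Complex.conj_conj]

lemma isClosed_adjointPairs (T : Z →L[ℂ] Z →SL[starRingEnd ℂ] (Z →L[ℂ] Z)) :
    IsClosed (adjointPairs T : Set ((Z →L[ℂ] Z) × (ConjSpace Z →L[ℂ] ConjSpace Z)ᵐᵒᵖ)) := by
  have c₁ : ∀ z : Z, Continuous
      fun p : (Z →L[ℂ] Z) × (ConjSpace Z →L[ℂ] ConjSpace Z)ᵐᵒᵖ => p.1 z :=
    fun z => by fun_prop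
  have c₂ : ∀ z : Z, Continuous
      fun p : (Z →L[ℂ] Z) × (ConjSpace Z →L[ℂ] ConjSpace Z)ᵐᵒᵖ => unconjMap p.2.unop z :=
    fun z => (toConj (Z := Z)).symm.continuous.comp
      ((apply ℂ (ConjSpace Z) (toConj z)).continuous.comp
        (MulOpposite.continuous_unop.comp continuous_snd))
  have c₃ : ∀ h x : Z, Continuous fun w : Z => T h w x := fun h x => by fun_prop
  have c₄ : ∀ h w : Z, Continuous fun x : Z => T h w x := fun h x => by fun_prop
  have : (adjointPairs T : Set ((Z →L[ℂ] Z) × (ConjSpace Z →L[ℂ] ConjSpace Z)ᵐᵒᵖ)) =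
      (⋂ h, ⋂ w, ⋂ x, {p | T h (p.1 w) x = T h w (unconjMap p.2.unop x)}) ∩
      (⋂ h, ⋂ w, ⋂ x, {p | T h (unconjMap p.2.unop w) x = T h w (p.1 x)}) := by
    ext p
    simp only [Set.mem_inter_iff, Set.mem_iInter]
    rfl
  rw [this]
  refine IsClosed.inter ?_ ?_
  · exact isClosed_iInter fun h => isClosed_iInter fun w => isClosed_iInter fun x =>
      isClosed_eq ((c₃ h x).comp (c₁ w)) ((c₄ h w).comp (c₂ x))
  · exact isClosed_iInter fun h => isClosed_iInter fun w => isClosed_iInter fun x =>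
      isClosed_eq ((c₃ h x).comp (c₂ w)) ((c₄ h w).comp (c₁ x))

namespace IsCStarTernary

variable {T : Z →L[ℂ] Z →SL[starRingEnd ℂ] (Z →L[ℂ] Z)}

lemma norm_sq_apply_le (hT : IsCStarTernary T) {f g : Z →L[ℂ] Z}
    (h : IsTernaryAdjoint T f g) (x : Z) : ‖f x‖ ^ 2 ≤ ‖g (f x)‖ * ‖x‖ := by
  rcases (norm_nonneg (f x)).eq_or_lt with h0 | h0
  · rw [← h0, zero_pow two_ne_zero]
    positivity
  · have h1 : ‖f x‖ ^ 3 ≤ ‖f x‖ * ‖x‖ * ‖g (f x)‖ := by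
      rw [← hT.norm_cube, h]
      exact hT.norm_le _ _ _
    refine le_of_mul_le_mul_left ?_ h0
    calc ‖f x‖ * ‖f x‖ ^ 2 = ‖f x‖ ^ 3 := by ring
      _ ≤ _ := h1
      _ = _ := by ring

lemma norm_sq_le_norm_comp (hT : IsCStarTernary T) {f g : Z →L[ℂ] Z}
    (h : IsTernaryAdjoint T f g) : ‖f‖ ^ 2 ≤ ‖g.comp f‖ := by
  refine (Real.le_sqrt (norm_nonneg _) (norm_nonneg _)).mp ?_
  refine opNorm_le_bound _ (Real.sqrt_nonneg _) fun x => ?_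
  refine le_of_sq_le_sq ?_ (by positivity)
  rw [mul_pow, Real.sq_sqrt (norm_nonneg _)]
  calc ‖f x‖ ^ 2 ≤ ‖g (f x)‖ * ‖x‖ := hT.norm_sq_apply_le h x
    _ ≤ (‖g.comp f‖ * ‖x‖) * ‖x‖ := by
      gcongr
      exact (g.comp f).le_opNorm x
    _ = ‖g.comp f‖ * ‖x‖ ^ 2 := by ring

lemma eq_zero_of_apply (hT : IsCStarTernary T) {u : Z} (hu : ∀ h w, T h w u = 0) : u = 0 := by
  have h := hT.norm_cube u
  rw [hu, norm_zero] at h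
  exact norm_eq_zero.mp (pow_eq_zero_iff three_ne_zero |>.mp h.symm)

/-- The C*-algebra of adjointable operators of a C*-ternary ring, acting on the left. -/
def AdjointAlgebra (_ : IsCStarTernary T) : Type _ := adjointPairs T

namespace AdjointAlgebra

variable (hT : IsCStarTernary T)

instance : NormedRing hT.AdjointAlgebra := inferInstanceAs (NormedRing (adjointPairs T))

instance : NormedAlgebra ℂ hT.AdjointAlgebra :=
  inferInstanceAs (NormedAlgebra ℂ (adjointPairs T))

instance [CompleteSpace Z] : CompleteSpace hT.AdjointAlgebra :=
  (isClosed_adjointPairs T).completeSpace_coe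

instance : Star hT.AdjointAlgebra :=
  ⟨fun s => ⟨(unconjMap s.1.2.unop, op (conjMap s.1.1)), s.2.2, s.2.1⟩⟩

instance : StarRing hT.AdjointAlgebra where
  star_involutive _ := rfl
  star_mul _ _ := rfl
  star_add _ _ := rfl

instance : StarModule ℂ hT.AdjointAlgebra where
  star_smul c s := by
    refine Subtype.ext (Prod.ext rfl (MulOpposite.unop_injective ?_))
    ext z
    have h : (starRingEnd ℂ (starRingEnd ℂ c)) • s.1.1 (toConj.symm z) =
      c • s.1.1 (toConj.symm z) := by rw [Complex.conj_conj]
    exact h.symm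

instance : CStarRing hT.AdjointAlgebra where
  norm_mul_self_le s := by
    have h₁ := hT.norm_sq_le_norm_comp s.2.1
    have h₂ := hT.norm_sq_le_norm_comp s.2.2
    have h₃ := opNorm_comp_le (unconjMap s.1.2.unop) s.1.1
    have h₄ := opNorm_comp_le s.1.1 (unconjMap s.1.2.unop)
    have h₅ : ‖s‖ = max ‖s.1.1‖ ‖unconjMap s.1.2.unop‖ := by
      rw [norm_unconjMap]
      rfl
    have h₆ : ‖(unconjMap s.1.2.unop).comp s.1.1‖ ≤ ‖star s * s‖ := le_max_left _ _
    have h₇ := norm_nonneg s.1.1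
    have h₈ := norm_nonneg (unconjMap s.1.2.unop)
    have h₉ : ‖s‖ = ‖s.1.1‖ := by
      rw [h₅]
      exact max_eq_left (by nlinarith)
    nlinarith

instance [CompleteSpace Z] : CStarAlgebra hT.AdjointAlgebra where

/-- The action of the algebra of adjointable operators. -/
def act : hT.AdjointAlgebra →L[ℂ] (Z →L[ℂ] Z) :=
  LinearMap.mkContinuous
    { toFun := fun s => s.1.1
      map_add' := fun _ _ => rfl
      map_smul' := fun _ _ => rfl }
    1 (fun s => by
      rw [one_mul]
      exact le_max_left _ _)

lemma norm_act_apply_le (s : hT.AdjointAlgebra) (z : Z) : ‖act hT s z‖ ≤ ‖s‖ * ‖z‖ :=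
  ((act hT s).le_opNorm z).trans (by
    gcongr
    exact le_max_left _ _)

lemma act_mul (s r : hT.AdjointAlgebra) (z : Z) : act hT (s * r) z = act hT s (act hT r z) := rfl

lemma act_one (z : Z) : act hT 1 z = z := rfl

lemma triple_act_mid (s : hT.AdjointAlgebra) (h w x : Z) :
    T h (act hT s w) x = T h w (act hT (star s) x) := s.2.1 h w x

lemma ext_act {s r : hT.AdjointAlgebra} (h₁ : ∀ z, act hT s z = act hT r z)
    (h₂ : ∀ z, act hT (star s) z = act hT (star r) z) : s = r :=
  Subtype.ext (Prod.ext (ContinuousLinearMap.ext h₁)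
    (MulOpposite.unop_injective (ContinuousLinearMap.ext h₂)))

lemma act_triple (s : hT.AdjointAlgebra) (x y z : Z) :
    act hT s (T x y z) = T (act hT s x) y z := by
  refine sub_eq_zero.mp (hT.eq_zero_of_apply fun h w => ?_)
  have h1 : ∀ v, T h w (act hT s v) = T h (act hT (star s) w) v := fun v => by
    rw [triple_act_mid, star_star]
  rw [map_sub, h1, ← hT.assoc_right, ← hT.assoc_right, hT.assoc_mid, hT.assoc_mid,
    triple_act_mid, sub_eq_zero]

/-- The operator `z ↦ [h g z]`, as an element of the algebra of adjointable operators. -/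
def leftMul₀ (h g : Z) : hT.AdjointAlgebra :=
  ⟨(T h g, op (conjMap (T g h))),
    fun u w x => by
      show T u (T h g w) x = T u w (T g h x)
      rw [← hT.assoc_mid, hT.assoc_right],
    fun u w x => by
      show T u (T g h w) x = T u w (T h g x)
      rw [← hT.assoc_mid, hT.assoc_right]⟩

lemma act_leftMul₀ (h g z : Z) : act hT (leftMul₀ hT h g) z = T h g z := rfl

lemma star_leftMul₀ (h g : Z) : star (leftMul₀ hT h g) = leftMul₀ hT g h := rfl

lemma norm_leftMul₀_le (h g : Z) : ‖leftMul₀ hT h g‖ ≤ ‖h‖ * ‖g‖ := by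
  refine max_le (opNorm_le_bound _ (by positivity) fun z => hT.norm_le h g z) ?_
  refine (norm_conjMap_le (T g h)).trans (opNorm_le_bound _ (by positivity) fun z => ?_)
  rw [mul_comm ‖h‖]
  exact hT.norm_le g h z

/-- The operators `z ↦ [h g z]`, as a sesquilinear map to the algebra of adjointable operators. -/
def leftMul : Z →L[ℂ] Z →L⋆[ℂ] hT.AdjointAlgebra :=
  LinearMap.mkContinuous₂
    (LinearMap.mk₂'ₛₗ (RingHom.id ℂ) (starRingEnd ℂ) (leftMul₀ hT)
      (fun h₁ h₂ g => ext_act hT (fun z => by simp [act_leftMul₀])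
        (fun z => by simp [act_leftMul₀, star_leftMul₀]))
      (fun c h g => ext_act hT (fun z => by simp [act_leftMul₀])
        (fun z => by simp [act_leftMul₀, star_leftMul₀]))
      (fun h g₁ g₂ => ext_act hT (fun z => by simp [act_leftMul₀])
        (fun z => by simp [act_leftMul₀, star_leftMul₀]))
      (fun c h g => ext_act hT (fun z => by simp [act_leftMul₀])
        (fun z => by simp [act_leftMul₀, star_leftMul₀]))) 1 (fun h g => by
        rw [one_mul]
        exact norm_leftMul₀_le hT h g)

lemma act_leftMul (h g z : Z) : act hT (leftMul hT h g) z = T h g z := rfl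

lemma star_leftMul (h g : Z) : star (leftMul hT h g) = leftMul hT g h := rfl

end AdjointAlgebra

end IsCStarTernary

/-- A selfadjoint element of a C*-algebra can be compressed to a small one by a contraction that
differs from `1` by a multiple of the element. -/
lemma IsSelfAdjoint.exists_norm_compression_le {𝔄 : Type*} [CStarAlgebra 𝔄] {a : 𝔄}
    (ha : IsSelfAdjoint a) {ε : ℝ} (hε : 0 < ε) :
    ∃ e s : 𝔄, IsSelfAdjoint e ∧ ‖e‖ ≤ 1 ∧ ‖e * a * e‖ ≤ ε ∧ e = 1 - s * a := by
  have hpos : ∀ x : ℝ, 0 < ε ^ 2 + x ^ 2 := fun x => by positivity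
  have hc₁ : Continuous fun x : ℝ => ε ^ 2 / (ε ^ 2 + x ^ 2) :=
    continuous_const.div (by fun_prop) fun x => (hpos x).ne'
  have hc₂ : Continuous fun x : ℝ => x / (ε ^ 2 + x ^ 2) :=
    continuous_id.div (by fun_prop) fun x => (hpos x).ne'
  have hc₃ : Continuous fun x : ℝ => ε ^ 2 / (ε ^ 2 + x ^ 2) * x := hc₁.mul continuous_id
  have hc₄ : Continuous fun x : ℝ => x / (ε ^ 2 + x ^ 2) * x := hc₂.mul continuous_id
  have hle : ∀ x : ℝ, ε ^ 2 / (ε ^ 2 + x ^ 2) ≤ 1 := fun x => by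
    rw [div_le_one (hpos x)]
    nlinarith [sq_nonneg x]
  have hnn : ∀ x : ℝ, 0 ≤ ε ^ 2 / (ε ^ 2 + x ^ 2) := fun x => by positivity
  refine ⟨cfc (fun x : ℝ => ε ^ 2 / (ε ^ 2 + x ^ 2)) a, cfc (fun x : ℝ => x / (ε ^ 2 + x ^ 2)) a,
    cfc_predicate _ a, norm_cfc_le zero_le_one fun x _ => ?_, ?_, ?_⟩
  · rw [Real.norm_of_nonneg (hnn x)]
    exact hle x
  · have h : cfc (fun x : ℝ => ε ^ 2 / (ε ^ 2 + x ^ 2)) a * a *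
        cfc (fun x : ℝ => ε ^ 2 / (ε ^ 2 + x ^ 2)) a =
        cfc (fun x : ℝ => ε ^ 2 / (ε ^ 2 + x ^ 2) * x * (ε ^ 2 / (ε ^ 2 + x ^ 2))) a := by
      rw [cfc_mul _ _ a hc₃.continuousOn hc₁.continuousOn,
        cfc_mul _ _ a hc₁.continuousOn (by fun_prop),
        cfc_id' ℝ a]
    rw [h]
    refine norm_cfc_le hε.le fun x _ => ?_
    rw [norm_mul, norm_mul, Real.norm_of_nonneg (hnn x), Real.norm_eq_abs]
    have h1 : ε ^ 2 / (ε ^ 2 + x ^ 2) * |x| ≤ ε := by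
      rw [div_mul_eq_mul_div, div_le_iff₀ (hpos x)]
      have h2 : ε * |x| ≤ ε ^ 2 + x ^ 2 := by
        rw [← sq_abs x]
        nlinarith [sq_nonneg (ε - |x|), sq_nonneg ε, sq_nonneg |x|]
      nlinarith
    calc _ ≤ ε * 1 := mul_le_mul h1 (hle x) (hnn x) hε.le
      _ = ε := mul_one ε
  · rw [← cfc_const_one ℝ a]
    nth_rw 4 [← cfc_id' ℝ a]
    rw [← cfc_mul _ _ a hc₂.continuousOn (by fun_prop),
      ← cfc_sub _ _ a continuousOn_const hc₄.continuousOn]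
    congr 1
    ext x
    have := (hpos x).ne'
    field_simp
    ring

lemma ContinuousLinearMap.exists_sub_le_re_apply {E : Type*} [NormedAddCommGroup E]
    [NormedSpace ℂ E] (φ : E →L[ℂ] ℂ) {δ : ℝ} (hδ : 0 < δ) :
    ∃ x : E, ‖x‖ ≤ 1 ∧ ‖φ‖ - δ ≤ (φ x).re := by
  rcases (norm_nonneg φ).eq_or_lt with h0 | h0
  · exact ⟨0, by simp, by simp [← h0, hδ.le]⟩
  obtain ⟨x, hx, hφ⟩ := φ.exists_lt_apply_of_lt_opNorm (sub_lt_self ‖φ‖ hδ)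
  obtain ⟨c, hc, hcx⟩ := RCLike.exists_norm_eq_mul_self (φ x)
  refine ⟨c • x, by rw [norm_smul, hc, one_mul]; exact hx.le, ?_⟩
  rw [map_smul, smul_eq_mul, ← hcx]
  exact hφ.le

namespace IsCStarTernary

open AdjointAlgebra

variable {T : Z →L[ℂ] Z →SL[starRingEnd ℂ] (Z →L[ℂ] Z)} (hT : IsCStarTernary T)

include hT

lemma norm_act_sq_le {e : hT.AdjointAlgebra} (he : IsSelfAdjoint e) (x : Z) :
    ‖act hT e x‖ ^ 2 ≤ ‖e * leftMul hT x x * e‖ := by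
  rcases (norm_nonneg (act hT e x)).eq_or_lt with h0 | h0
  · rw [← h0, zero_pow two_ne_zero]
    positivity
  have h1 : T (act hT e x) (act hT e x) (act hT e x) =
      act hT (e * leftMul hT x x * e) (act hT e x) := by
    rw [act_mul, act_mul, act_leftMul, act_triple, triple_act_mid, he.star_eq]
  have h2 := norm_act_apply_le hT (e * leftMul hT x x * e) (act hT e x)
  rw [← h1, hT.norm_cube] at h2
  refine le_of_mul_le_mul_right ?_ h0
  calc ‖act hT e x‖ ^ 2 * ‖act hT e x‖ = ‖act hT e x‖ ^ 3 := by ring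
    _ ≤ _ := h2

lemma norm_add_smul_act_sq_le {e : hT.AdjointAlgebra} (he : IsSelfAdjoint e) (he1 : ‖e‖ ≤ 1)
    {t : ℝ} (ht : 0 ≤ t) {x y : Z} (hx : ‖x‖ ≤ 1) (hy : ‖y‖ ≤ 1) (hex : ‖act hT e x‖ ≤ t)
    {r : ℂ} (hr : ‖r‖ = t) : ‖x + r • act hT e y‖ ^ 2 ≤ 1 + 3 * t ^ 2 := by
  set z := x + r • act hT e y with hz
  rcases (norm_nonneg z).eq_or_lt with h0 | h0
  · rw [← h0, zero_pow two_ne_zero]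
    positivity
  have hey : ‖act hT e y‖ ≤ 1 :=
    (norm_act_apply_le hT e y).trans (mul_le_one₀ he1 (norm_nonneg _) hy)
  have h1 : T z z z = T z x x + r • T z (act hT e x) y +
      (starRingEnd ℂ r) • T z y (act hT e x) +
      (starRingEnd ℂ r * r) • T z (act hT e y) (act hT e y) := by
    have h2 : T z x (act hT e y) = T z (act hT e x) y := by rw [triple_act_mid, he.star_eq]
    have h3 : T z y (act hT e x) = T z (act hT e y) x := by rw [triple_act_mid, he.star_eq]
    have h : ∀ u v : Z, T u (x + r • v) (x + r • v) = T u x x + r • T u x v +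
        (starRingEnd ℂ r) • T u v x + (starRingEnd ℂ r * r) • T u v v := fun u v => by
      simp only [map_add, map_smul, map_smulₛₗ, add_apply, smul_apply]
      module
    rw [h3, ← h2]
    exact h z _
  have hb : ∀ u v : Z, ∀ p q : ℝ, ‖u‖ ≤ p → ‖v‖ ≤ q → ‖T z u v‖ ≤ ‖z‖ * p * q := by
    intro u v p q hu hv
    have hp := (norm_nonneg u).trans hu
    exact (hT.norm_le z u v).trans (by gcongr)
  have h4 : ‖T z z z‖ ≤ ‖z‖ * 1 * 1 + t * (‖z‖ * t * 1) + t * (‖z‖ * 1 * t) +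
      (t * t) * (‖z‖ * 1 * 1) := by
    rw [h1]
    refine (norm_add₄_le).trans ?_
    simp only [norm_smul, norm_mul, RCLike.norm_conj, hr]
    gcongr
    · exact hb _ _ _ _ hx hx
    · exact hb _ _ _ _ hex hy
    · exact hb _ _ _ _ hy hex
    · exact hb _ _ _ _ hey hey
  rw [hT.norm_cube] at h4
  refine le_of_mul_le_mul_right ?_ h0
  linarith [h4]

/-- The functionals of the form `z ↦ ψ [x x z]` are dense in the dual of a C*-ternary ring. -/
lemma exists_norm_sub_comp_le [CompleteSpace Z] (φ : Z →L[ℂ] ℂ) {ε : ℝ} (hε : 0 < ε) :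
    ∃ (x : Z) (ψ : Z →L[ℂ] ℂ), ‖φ - ψ.comp (T x x)‖ ≤ ε := by
  set M := ‖φ‖ with hM
  have hM0 : 0 ≤ M := norm_nonneg φ
  obtain ⟨t, ht, htε⟩ : ∃ t : ℝ, 0 < t ∧ t * (1 + 2 * M) = ε :=
    ⟨ε / (1 + 2 * M), by positivity, by field_simp⟩
  obtain ⟨x, hx, hφx⟩ := φ.exists_sub_le_re_apply (pow_pos ht 2)
  obtain ⟨e, s, he, he1, hee, hs⟩ := IsSelfAdjoint.exists_norm_compression_le
    (show IsSelfAdjoint (leftMul hT x x) from star_leftMul hT x x) (pow_pos ht 2)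
  have hex : ‖act hT e x‖ ≤ t :=
    le_of_sq_le_sq ((norm_act_sq_le hT he x).trans hee) ht.le
  refine ⟨x, φ.comp (act hT s), opNorm_le_of_unit_norm hε.le fun y hy => ?_⟩
  have h1 : (φ - (φ.comp (act hT s)).comp (T x x)) y = φ (act hT e y) := by
    rw [hs, map_sub, sub_apply (act hT 1), act_one, act_mul, act_leftMul, map_sub]
    rfl
  rw [h1]
  obtain ⟨c, hc, hcφ⟩ := RCLike.exists_norm_eq_mul_self (φ (act hT e y))
  have h2 := norm_add_smul_act_sq_le hT he he1 ht.le hx hy.le hex (r := t * c)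
    (by rw [norm_mul, hc, mul_one, Complex.norm_real, Real.norm_of_nonneg ht.le])
  set z := x + (t * c : ℂ) • act hT e y with hz
  have h3 : ‖z‖ ≤ 1 + 3 / 2 * t ^ 2 := by
    refine le_of_sq_le_sq (h2.trans ?_) (by positivity)
    nlinarith [sq_nonneg (t ^ 2)]
  have h4 : (φ z).re = (φ x).re + t * ‖φ (act hT e y)‖ := by
    rw [hz, map_add, map_smul, smul_eq_mul, mul_assoc, ← hcφ, Complex.add_re,
      Complex.re_ofReal_mul]
    rfl
  have h5 : (φ z).re ≤ M * ‖z‖ := (Complex.re_le_norm _).trans (φ.le_opNorm z)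
  have h6 : M * ‖z‖ ≤ M * (1 + 3 / 2 * t ^ 2) := by gcongr
  refine le_of_mul_le_mul_left ?_ ht
  rw [← htε]
  nlinarith [mul_nonneg hM0 (sq_nonneg t)]

end IsCStarTernary

/-- The opposite of a trilinear map, `(f, g, h) ↦ [h g f]`. -/
def opTriple : A →L[ℂ] B →SL[starRingEnd ℂ] (C →L[ℂ] D) :=
  (((flipₗᵢ ℂ C A D : (C →L[ℂ] A →L[ℂ] D) ≃ₗᵢ[ℂ] (A →L[ℂ] C →L[ℂ] D)) :
    (C →L[ℂ] A →L[ℂ] D) →L[ℂ] (A →L[ℂ] C →L[ℂ] D)).comp t.flip).flip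

@[simp] lemma opTriple_apply (f : A) (g : B) (h : C) : opTriple t f g h = t h g f := rfl

lemma norm_arens3_apply_sub_le (H : (C →L[ℂ] ℂ) →L[ℂ] ℂ) (G : (B →L[ℂ] ℂ) →L[ℂ] ℂ)
    (F : (A →L[ℂ] ℂ) →L[ℂ] ℂ) (φ φ' : D →L[ℂ] ℂ) :
    ‖arens3 t H G F φ - arens3 t H G F φ'‖ ≤ ‖F‖ * (‖G‖ * (‖H‖ * (‖φ - φ'‖ * ‖t‖))) := by
  rw [← map_sub]
  exact (F.le_opNorm _).trans (by gcongr; exact mu2_norm_le t G H _)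

/-- Being given by evaluation at a functional is a closed condition on maps on a bidual. -/
lemma exists_eval_of_dense {E W : Type*} [NormedAddCommGroup E] [NormedSpace ℂ E]
    [NormedAddCommGroup W] (N : W → ((E →L[ℂ] ℂ) →L[ℂ] ℂ) → ℂ) (K : ℝ)
    (hN : ∀ φ φ' Ψ, ‖N φ Ψ - N φ' Ψ‖ ≤ K * ‖φ - φ'‖ * ‖Ψ‖) (φ : W)
    (h : ∀ ε > 0, ∃ φ', ‖φ - φ'‖ ≤ ε ∧ ∃ ν, ∀ Ψ, N φ' Ψ = Ψ ν) :
    ∃ ν : E →L[ℂ] ℂ, ∀ Ψ, N φ Ψ = Ψ ν := by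
  choose u hu ν hν using fun n : ℕ => h (1 / (n + 1)) Nat.one_div_pos_of_nat
  have hlim : Filter.Tendsto u Filter.atTop (nhds φ) := by
    refine tendsto_iff_norm_sub_tendsto_zero.mpr (squeeze_zero (fun _ => norm_nonneg _)
      (fun n => ?_) tendsto_one_div_add_atTop_nhds_zero_nat)
    rw [norm_sub_rev]
    exact hu n
  have hdist : ∀ n m, dist (ν n) (ν m) ≤ |K| * dist (u n) (u m) := by
    intro n m
    rw [dist_eq_norm, dist_eq_norm]
    refine opNorm_le_bound _ (by positivity) fun x => ?_
    have h₁ := hN (u n) (u m) (evalL x)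
    rw [hν, hν] at h₁
    have h₂ : ‖(evalL x : (E →L[ℂ] ℂ) →L[ℂ] ℂ)‖ ≤ ‖x‖ :=
      LinearMap.mkContinuous_norm_le _ (norm_nonneg _) _
    calc ‖(ν n - ν m) x‖ ≤ K * ‖u n - u m‖ * ‖(evalL x : (E →L[ℂ] ℂ) →L[ℂ] ℂ)‖ := h₁
      _ ≤ |K| * ‖u n - u m‖ * ‖x‖ := by
        gcongr
        exact le_abs_self K
  have hcau : CauchySeq ν := by
    refine Metric.cauchySeq_iff'.mpr fun ε hε => ?_
    obtain ⟨n₀, hn₀⟩ := Metric.cauchySeq_iff'.mp hlim.cauchySeq (ε / (|K| + 1)) (by positivity)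
    refine ⟨n₀, fun n hn => (hdist n n₀).trans_lt ?_⟩
    have h₁ := hn₀ n hn
    rw [lt_div_iff₀ (by positivity)] at h₁
    nlinarith [dist_nonneg (x := u n) (y := u n₀)]
  obtain ⟨ν', hν'⟩ := cauchySeq_tendsto_of_complete hcau
  refine ⟨ν', fun Ψ => tendsto_nhds_unique (f := fun n => N (u n) Ψ) (l := Filter.atTop) ?_ ?_⟩
  · refine tendsto_iff_norm_sub_tendsto_zero.mpr (squeeze_zero (fun _ => norm_nonneg _)
      (fun n => hN (u n) φ Ψ) ?_)
    have h₁ := ((tendsto_iff_norm_sub_tendsto_zero.mp hlim).const_mul K).mul_const ‖Ψ‖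
    simpa using h₁
  · simp only [hν]
    exact (Ψ.continuous.tendsto ν').comp hν'

namespace IsCStarTernary

open AdjointAlgebra

variable {T : Z →L[ℂ] Z →SL[starRingEnd ℂ] (Z →L[ℂ] Z)} (hT : IsCStarTernary T)

include hT in
/-- The opposite triple product is again a C*-ternary product. -/
lemma op : IsCStarTernary (opTriple T) where
  assoc_mid v w x y z := by
    simp only [opTriple_apply]
    rw [← hT.assoc_right, hT.assoc_mid]
  assoc_right v w x y z := by
    simp only [opTriple_apply]
    rw [hT.assoc_right]
  norm_le x y z := by
    rw [opTriple_apply]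
    refine (hT.norm_le z y x).trans (le_of_eq (by ring))
  norm_cube x := hT.norm_cube x

/-- The trilinear map `(h, g, b) ↦ L(h, g) * b`, where `L(h, g)` is the operator `z ↦ [h g z]`. -/
def leftMulTriple : Z →L[ℂ] Z →SL[starRingEnd ℂ] (hT.AdjointAlgebra →L[ℂ] hT.AdjointAlgebra) :=
  ((compSL Z hT.AdjointAlgebra (hT.AdjointAlgebra →L[ℂ] hT.AdjointAlgebra) (starRingEnd ℂ)
    (RingHom.id ℂ)) (ContinuousLinearMap.mul ℂ hT.AdjointAlgebra)).comp (leftMul hT)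

/-- The functional `c ↦ ψ (c x)`. -/
def vectorFunctional (ψ : Z →L[ℂ] ℂ) (x : Z) : hT.AdjointAlgebra →L[ℂ] ℂ :=
  ψ.comp ((evalL x).comp (act hT))

lemma vectorFunctional_mul (ψ : Z →L[ℂ] ℂ) (x f g h : Z) :
    hT.vectorFunctional ψ x (leftMul hT h g * leftMul hT f x) = ψ (T (T h g f) x x) := by
  rw [hT.assoc_right]
  rfl

variable [CompleteSpace Z]

include hT

lemma exists_eval_mid_of_factor (ψ : Z →L[ℂ] ℂ) (x : Z) (H F : (Z →L[ℂ] ℂ) →L[ℂ] ℂ) :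
    ∃ ν : Z →L[ℂ] ℂ, ∀ G,
      (starRingEnd ℂ) (arens3 T H G F (ψ.comp (opTriple T x x))) = G ν := by
  let ω := hT.vectorFunctional ψ x
  let K : Z →L[ℂ] hT.AdjointAlgebra := (leftMul hT).flip x
  let F' : (hT.AdjointAlgebra →L[ℂ] ℂ) →L[ℂ] ℂ := F.comp (precomp ℂ K)
  refine ⟨mu1 hT.leftMulTriple H (F'.comp (mulForm ω)) 1, fun G => ?_⟩
  let G' := arens3 hT.leftMulTriple H G (_root_.evalL 1)
  have h₀ : ∀ f g, mu0 T (ψ.comp (opTriple T x x)) f g =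
      mu0 hT.leftMulTriple ((mulForm ω).flip (K f)) 1 g := fun f g => by
    ext h
    refine (hT.vectorFunctional_mul ψ x f g h).symm.trans ?_
    change ω _ = ω (leftMul hT h g * 1 * K f)
    rw [mul_one]
    rfl
  have h₁ : ∀ f, mu1 T H (ψ.comp (opTriple T x x)) f =
      mu1 hT.leftMulTriple H ((mulForm ω).flip (K f)) 1 := fun f => by
    ext g
    rw [mu1_apply, mu1_apply, h₀]
  have h₂ : mu2 T G H (ψ.comp (opTriple T x x)) = (G'.comp (mulForm ω).flip).comp K := by
    ext f
    rw [mu2_apply, h₁]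
    rfl
  rw [arens3_apply, h₂]
  change (starRingEnd ℂ) (F' (G'.comp (mulForm ω).flip)) = _
  rw [isArensRegularForm_mulForm ω F' G']
  exact Complex.conj_conj _

lemma exists_eval_left_of_factor (ψ : Z →L[ℂ] ℂ) (x : Z) (G F : (Z →L[ℂ] ℂ) →L[ℂ] ℂ) :
    ∃ ν : Z →L[ℂ] ℂ, ∀ H, arens3 T H G F (ψ.comp (T x x)) = H ν := by
  let ω := hT.op.vectorFunctional ψ x
  let K : Z →L[ℂ] hT.op.AdjointAlgebra := (leftMul hT.op).flip x
  let τ := opTriple hT.op.leftMulTriple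
  let G' := arens3 τ (_root_.evalL 1) G F
  refine ⟨(G'.comp (mulForm ω).flip).comp K, fun H => ?_⟩
  let H' : (hT.op.AdjointAlgebra →L[ℂ] ℂ) →L[ℂ] ℂ := H.comp (precomp ℂ K)
  have h₀ : ∀ f g, mu0 T (ψ.comp (T x x)) f g =
      (mulForm ω (leftMul hT.op f g)).comp K := fun f g => by
    ext h
    exact (hT.op.vectorFunctional_mul ψ x h g f).symm
  have h₁ : ∀ f, mu1 T H (ψ.comp (T x x)) f =
      mu1 τ (_root_.evalL 1) (H'.comp (mulForm ω)) f := fun f => by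
    ext g
    rw [mu1_apply, h₀, mu1_apply]
    change _ = (starRingEnd ℂ) (H' (mulForm ω (leftMul hT.op f g * 1)))
    rw [mul_one]
    rfl
  have h₂ : mu2 T G H (ψ.comp (T x x)) = mu2 τ G (_root_.evalL 1) (H'.comp (mulForm ω)) := by
    ext f
    rw [mu2_apply, h₁]
    rfl
  rw [arens3_apply, h₂]
  exact (isArensRegularForm_mulForm ω H' G').symm

lemma exists_eval_mid (φ : Z →L[ℂ] ℂ) (H F : (Z →L[ℂ] ℂ) →L[ℂ] ℂ) :
    ∃ ν : Z →L[ℂ] ℂ, ∀ G, (starRingEnd ℂ) (arens3 T H G F φ) = G ν := by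
  refine exists_eval_of_dense (fun φ G => (starRingEnd ℂ) (arens3 T H G F φ))
    (‖F‖ * ‖H‖ * ‖T‖) (fun φ φ' G => ?_) φ fun ε hε => ?_
  · rw [← map_sub, RCLike.norm_conj]
    exact (norm_arens3_apply_sub_le T H G F φ φ').trans (le_of_eq (by ring))
  · obtain ⟨x, ψ, h⟩ := hT.op.exists_norm_sub_comp_le φ hε
    exact ⟨_, h, hT.exists_eval_mid_of_factor ψ x H F⟩

lemma exists_eval_left (φ : Z →L[ℂ] ℂ) (G F : (Z →L[ℂ] ℂ) →L[ℂ] ℂ) :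
    ∃ ν : Z →L[ℂ] ℂ, ∀ H, arens3 T H G F φ = H ν := by
  refine exists_eval_of_dense (fun φ H => arens3 T H G F φ)
    (‖F‖ * ‖G‖ * ‖T‖) (fun φ φ' H => ?_) φ fun ε hε => ?_
  · exact (norm_arens3_apply_sub_le T H G F φ φ').trans (le_of_eq (by ring))
  · obtain ⟨x, ψ, h⟩ := hT.exists_norm_sub_comp_le φ hε
    exact ⟨_, h, hT.exists_eval_left_of_factor ψ x G F⟩

end IsCStarTernary

end Ternary

/-- Let `Z` be a C*-ternary ring (a complex Banach space with a bounded triple product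
`[x y z] = T x y z`, linear in the outer variables, conjugate-linear in the middle
variable, associative in the sense that `[[v w x] y z] = [v [y x w] z] = [v w [x y z]]`,
with `‖[x y z]‖ ≤ ‖x‖‖y‖‖z‖` and `‖[x x x]‖ = ‖x‖³`).  Then the triple product of `Z` is
Arens regular: its Arens extension `t″ : Z″×Z″×Z″ → Z″` is separately weak*-continuous. -/
theorem cstarTernary_arens_regular
    {Z : Type*} [NormedAddCommGroup Z] [NormedSpace ℂ Z] [CompleteSpace Z]
    (T : Z →L[ℂ] Z →SL[starRingEnd ℂ] (Z →L[ℂ] Z))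
    (hassoc₁ : ∀ v w x y z : Z, T (T v w x) y z = T v (T y x w) z)
    (hassoc₂ : ∀ v w x y z : Z, T (T v w x) y z = T v w (T x y z))
    (hnorm : ∀ x y z : Z, ‖T x y z‖ ≤ ‖x‖ * ‖y‖ * ‖z‖)
    (hcube : ∀ x : Z, ‖T x x x‖ = ‖x‖ ^ 3) :
    SeparatelyWeakStarContinuous T := by
  have hT : IsCStarTernary T := ⟨hassoc₁, hassoc₂, hnorm, hcube⟩
  refine ⟨fun H G => ?_, fun H F => ?_, fun G F => ?_⟩
  · exact WeakDual.continuous_of_continuous_eval fun φ => WeakDual.eval_continuous (mu2 T G H φ)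
  · refine WeakDual.continuous_of_continuous_eval fun φ => ?_
    obtain ⟨ν, hν⟩ := hT.exists_eval_mid φ H F
    have h : ∀ G, arens3 T H G F φ = (starRingEnd ℂ) (G ν) := fun G => by
      rw [← hν, Complex.conj_conj]
    exact (Complex.continuous_conj.comp (WeakDual.eval_continuous ν)).congr fun G => (h G).symm
  · refine WeakDual.continuous_of_continuous_eval fun φ => ?_
    obtain ⟨ν, hν⟩ := hT.exists_eval_left φ G F
    exact (WeakDual.eval_continuous ν).congr fun H => (hν H).symm

end
end
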